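/- arXiv:math/0703801 — 6 statements merged into one kernel-verified Lean document; each statement's English description precedes it below -/
import Mathlib

section
/- Let A be a unital C*-algebra, δ : A → A a *-endomorphism with kernel I, and J an ideal of A orthogonal to I. Then: (1) the formula δ_J((a+I) ⊕ (b+J)) = (δ(a)+I) ⊕ (δ(a)+J) gives a well-defined *-endomorphism δ_J of A_J = (A/I) ⊕ (A/J); (2) Ker δ_J = {0} ⊕ (A/J), and this kernel is a unital algebra with unit (0+I) ⊕ (1+J); (3) the map a ↦ (a+I) ⊕ (a+J) is an injective *-homomorphism of A into A_J which intertwines δ with δ_J, i.e., δ_J((a+I) ⊕ (a+J)) = (δ(a)+I) ⊕ (δ(a)+J) for all a ∈ A. -/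
/-- A closed two-sided ideal of a C*-algebra, as a predicate on sets. -/
def IsClosedTwoSidedIdeal {A : Type*} [CStarAlgebra A] (J : Set A) : Prop :=
  IsClosed J ∧ (0 : A) ∈ J ∧ (∀ x ∈ J, ∀ y ∈ J, x + y ∈ J) ∧
    (∀ a : A, ∀ x ∈ J, a * x ∈ J) ∧ (∀ a : A, ∀ x ∈ J, x * a ∈ J)

/-- A `*`-homomorphism which vanishes on the kernel of a surjective `*`-homomorphism `q` factors
through `q`. -/
theorem NonUnitalStarAlgHom.exists_comp_eq_of_surjective {R A B C : Type*} [CommSemiring R]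
    [NonUnitalRing A] [Module R A] [Star A] [NonUnitalRing B] [Module R B] [Star B]
    [NonUnitalRing C] [Module R C] [Star C]
    (q : A →⋆ₙₐ[R] B) (hq : Function.Surjective q) (f : A →⋆ₙₐ[R] C)
    (h : ∀ a, q a = 0 → f a = 0) :
    ∃ g : B →⋆ₙₐ[R] C, ∀ a, g (q a) = f a := by
  have hs : ∀ x y, q x = q y → f x = f y := fun x y hxy ↦
    sub_eq_zero.1 <| by rw [← map_sub]; exact h _ (by rw [map_sub, hxy, sub_self])
  have hsurj := Function.surjInv_eq hq
  refine ⟨{ toFun := fun b ↦ f (Function.surjInv hq b)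
            map_smul' := fun r x ↦ ?_
            map_zero' := ?_
            map_add' := fun x y ↦ ?_
            map_mul' := fun x y ↦ ?_
            map_star' := fun x ↦ ?_ }, fun a ↦ hs _ _ (hsurj _)⟩
  · simpa using hs _ (r • Function.surjInv hq x) (by simp [hsurj])
  · simpa using hs _ 0 (by simp [hsurj])
  · simpa using hs _ (Function.surjInv hq x + Function.surjInv hq y) (by simp [hsurj])
  · simpa using hs _ (Function.surjInv hq x * Function.surjInv hq y) (by simp [hsurj])
  · exact (hs _ (star (Function.surjInv hq x)) (by simp [hsurj, map_star])).trans (map_star f _)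

/-- Let `δ : A → A` be a `*`-endomorphism of a unital C*-algebra with
kernel `I`, and let `J` be a closed two-sided ideal orthogonal to `I`.  Realize the
quotient C*-algebras `A/I` and `A/J` as unital C*-algebras `B₁`, `B₂` together with
surjective `*`-homomorphisms `q₁ : A → B₁`, `q₂ : A → B₂` whose kernels are `I` and `J`
respectively, so that `A_J = (A/I) ⊕ (A/J)` is the product C*-algebra `B₁ × B₂`.  Then:
(1) there is a (well-defined) `*`-endomorphism `δ_J` of `A_J` with
    `δ_J(q₁ a, q₂ b) = (q₁ (δ a), q₂ (δ a))`;
(2) the kernel of `δ_J` is `{0} ⊕ (A/J)`, and it is unital with unit `(0, q₂ 1)`;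
(3) the map `a ↦ (q₁ a, q₂ a)` is an injective `*`-homomorphism `A → A_J`
    intertwining `δ` with `δ_J`. -/
theorem exists_extension_deltaJ {A : Type*} [CStarAlgebra A]
    (δ : A →⋆ₙₐ[ℂ] A) (J : Set A) (hJ : IsClosedTwoSidedIdeal J)
    (horth : ∀ a ∈ J, δ a = 0 → a = 0)
    {B₁ : Type*} [CStarAlgebra B₁] {B₂ : Type*} [CStarAlgebra B₂]
    (q₁ : A →⋆ₐ[ℂ] B₁) (hq₁ : Function.Surjective q₁)
    (hker₁ : ∀ a : A, q₁ a = 0 ↔ δ a = 0)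
    (q₂ : A →⋆ₐ[ℂ] B₂) (hq₂ : Function.Surjective q₂)
    (hker₂ : ∀ a : A, q₂ a = 0 ↔ a ∈ J) :
    ∃ δJ : (B₁ × B₂) →⋆ₙₐ[ℂ] (B₁ × B₂),
      (∀ a b : A, δJ (q₁ a, q₂ b) = (q₁ (δ a), q₂ (δ a))) ∧
      (∀ x : B₁ × B₂, δJ x = 0 ↔ x.1 = 0) ∧
      (∀ x : B₁ × B₂, x.1 = 0 →
        ((0 : B₁), q₂ 1) * x = x ∧ x * ((0 : B₁), q₂ 1) = x) ∧
      Function.Injective (fun a : A => ((q₁ a, q₂ a) : B₁ × B₂)) ∧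
      (∀ a : A, δJ (q₁ a, q₂ a) = (q₁ (δ a), q₂ (δ a))) := by
  obtain ⟨d, hd⟩ := NonUnitalStarAlgHom.exists_comp_eq_of_surjective
    (q₁ : A →⋆ₙₐ[ℂ] B₁) hq₁ δ fun a ha ↦ (hker₁ a).1 ha
  replace hd : ∀ a, d (q₁ a) = δ a := hd
  have hinj : ∀ a, q₁ a = 0 → q₂ a = 0 → a = 0 := fun a h₁ h₂ ↦
    horth a ((hker₂ a).1 h₂) ((hker₁ a).1 h₁)
  let δJ : (B₁ × B₂) →⋆ₙₐ[ℂ] (B₁ × B₂) :=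
    ((q₁ : A →⋆ₙₐ[ℂ] B₁).prod (q₂ : A →⋆ₙₐ[ℂ] B₂)).comp
      (d.comp (NonUnitalStarAlgHom.fst ℂ B₁ B₂))
  have hδJ : ∀ x, δJ x = (q₁ (d x.1), q₂ (d x.1)) := fun _ ↦ rfl
  refine ⟨δJ, fun a b ↦ by simp [hδJ, hd], fun x ↦ ⟨fun hx ↦ ?_, fun hx ↦ by simp [hδJ, hx]⟩,
    fun x hx ↦ by simp [Prod.ext_iff, hx], fun a b hab ↦ ?_, fun a ↦ by simp [hδJ, hd]⟩
  · obtain ⟨a, ha⟩ := hq₁ x.1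
    rw [hδJ, ← ha, hd, Prod.mk_eq_zero] at hx
    rw [← ha, hker₁]
    exact hinj _ hx.1 hx.2
  · obtain ⟨h₁, h₂⟩ := Prod.mk.inj hab
    exact sub_eq_zero.1 <| hinj _ (by rw [map_sub, h₁, sub_self]) (by rw [map_sub, h₂, sub_self])
end

section
/- Let (π,U,H) be a covariant representation of (A,δ). Then {a ∈ A : (1−U*U)π(a) = π(a)} equals the kernel I of δ, and J := {a ∈ A : U*U π(a) = π(a)} is a closed two-sided ideal of A with I ∩ J = {0} (i.e., J is orthogonal to Ker δ). -/
/-- If `u` is a partial isometry whose initial projection commutes with `x`, then `u x u* = 0`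
exactly when the initial projection annihilates `x`. -/
theorem conj_eq_zero_iff_initialProj_mul_eq_zero {R : Type*} [Ring R] [StarRing R] {u x : R}
    (hu : u * star u * u = u) (hx : star u * u * x = x * (star u * u)) :
    u * x * star u = 0 ↔ star u * u * x = 0 := by
  constructor
  · intro h
    calc star u * u * x = star u * (u * star u * u) * x := by rw [hu]
      _ = star u * u * (star u * u * x) := by simp only [mul_assoc]
      _ = star u * u * (x * (star u * u)) := by rw [hx]
      _ = star u * (u * x * star u) * u := by simp only [mul_assoc]
      _ = 0 := by rw [h, mul_zero, zero_mul]
  · intro h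
    calc u * x * star u = u * star u * u * x * star u := by rw [hu]
      _ = u * (star u * u * x) * star u := by simp only [mul_assoc]
      _ = 0 := by rw [h, mul_zero, zero_mul]

/-- For a covariant representation `(π, U, H)` of `(A, δ)`, the set
`{a : (1 - U*U) π(a) = π(a)}` equals `Ker δ`, and `J = {a : U*U π(a) = π(a)}` is a
closed two-sided ideal of `A` orthogonal to `Ker δ`. -/
theorem covariantRep_ideal {A : Type*} [CStarAlgebra A] (δ : A →⋆ₙₐ[ℂ] A)
    {H : Type*} [NormedAddCommGroup H] [InnerProductSpace ℂ H] [CompleteSpace H]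
    (π : A →⋆ₐ[ℂ] (H →L[ℂ] H)) (U : H →L[ℂ] H)
    (hinj : Function.Injective π)
    (hU : U * star U * U = U)
    (hcov : ∀ a : A, U * π a * star U = π (δ a))
    (hcomm : ∀ a : A, star U * U * π a = π a * (star U * U)) :
    {a : A | (1 - star U * U) * π a = π a} = {a : A | δ a = 0} ∧
    IsClosedTwoSidedIdeal {a : A | star U * U * π a = π a} ∧
    {a : A | δ a = 0} ∩ {a : A | star U * U * π a = π a} = {0} := by
  have hker (a : A) : δ a = 0 ↔ star U * U * π a = 0 := by
    rw [← conj_eq_zero_iff_initialProj_mul_eq_zero hU (hcomm a), hcov,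
      map_eq_zero_iff π hinj]
  have hπ : Continuous π :=
    AddMonoidHomClass.continuous_of_bound π 1 fun a => by
      simpa only [one_mul] using NonUnitalStarAlgHom.norm_apply_le π a
  refine ⟨?_, ⟨?_, ?_, ?_, ?_, ?_⟩, ?_⟩
  · ext a
    simp only [Set.mem_ofPred_eq]
    rw [hker, sub_mul, one_mul, sub_eq_self]
  · exact isClosed_eq (continuous_const.mul hπ) hπ
  · simp
  · intro x hx y hy
    simp only [Set.mem_ofPred_eq] at hx hy ⊢
    rw [map_add, mul_add, hx, hy]
  · intro a x hx
    simp only [Set.mem_ofPred_eq] at hx ⊢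
    rw [map_mul, ← mul_assoc, hcomm, mul_assoc, hx]
  · intro a x hx
    simp only [Set.mem_ofPred_eq] at hx ⊢
    rw [map_mul, ← mul_assoc, hx]
  · ext a
    simp only [Set.mem_inter_iff, Set.mem_ofPred_eq, Set.mem_singleton_iff]
    constructor
    · rintro ⟨h, h'⟩
      rw [hker, h'] at h
      exact (map_eq_zero_iff π hinj).mp h
    · rintro rfl
      simp
end

section
/- Let (π,U,H) be a covariant representation of (A,δ), let I = Ker δ and J = {a ∈ A : U*U π(a) = π(a)}. Then the map π̃ : A_J → B(H) given by π̃((a+I) ⊕ (b+J)) = U*U π(a) + (1−U*U) π(b) is a well-defined injective *-homomorphism whose image is the C*-subalgebra of B(H) generated by π(A) ∪ {U*U}, it is the unique such extension of π with (π̃,U,H) covariant, and U π̃(x) U* = π̃(δ_J(x)) for all x ∈ A_J. -/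
/-- For a projection `p` commuting with the range of `π`, the star homomorphism
`(q₁ a, q₂ b) ↦ p π(a) + (1 - p) π(b)` induced on the product of two quotients of `A`. -/
noncomputable def StarAlgHom.prodOfProjection {A B₁ B₂ C : Type*}
    [Ring A] [StarRing A] [Algebra ℂ A] [Ring B₁] [StarRing B₁] [Algebra ℂ B₁]
    [Ring B₂] [StarRing B₂] [Algebra ℂ B₂] [Ring C] [StarRing C] [Algebra ℂ C]
    (π : A →⋆ₐ[ℂ] C) (p : C) (hp : p * p = p) (hps : star p = p)
    (hc : ∀ a, p * π a = π a * p)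
    (q₁ : A →⋆ₐ[ℂ] B₁) (hq₁ : Function.Surjective q₁)
    (q₂ : A →⋆ₐ[ℂ] B₂) (hq₂ : Function.Surjective q₂)
    (h₁ : ∀ a b, q₁ a = q₁ b → p * π a = p * π b)
    (h₂ : ∀ a b, q₂ a = q₂ b → (1 - p) * π a = (1 - p) * π b) :
    (B₁ × B₂) →⋆ₐ[ℂ] C :=
  have key (x : B₁ × B₂) (a b : A) (ha : q₁ a = x.1) (hb : q₂ b = x.2) :
      p * π (Function.surjInv hq₁ x.1) + (1 - p) * π (Function.surjInv hq₂ x.2) =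
        p * π a + (1 - p) * π b := by
    rw [h₁ _ a ((Function.surjInv_eq hq₁ _).trans ha.symm),
      h₂ _ b ((Function.surjInv_eq hq₂ _).trans hb.symm)]
  { toFun := fun x => p * π (Function.surjInv hq₁ x.1) + (1 - p) * π (Function.surjInv hq₂ x.2)
    map_one' := by
      rw [key 1 1 1 (map_one q₁) (map_one q₂), map_one]
      simp
    map_zero' := by
      rw [key 0 0 0 (map_zero q₁) (map_zero q₂), map_zero]
      simp
    map_mul' := by
      rintro ⟨x₁, x₂⟩ ⟨y₁, y₂⟩
      obtain ⟨a, rfl⟩ := hq₁ x₁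
      obtain ⟨b, rfl⟩ := hq₂ x₂
      obtain ⟨c, rfl⟩ := hq₁ y₁
      obtain ⟨d, rfl⟩ := hq₂ y₂
      rw [key _ (a * c) (b * d) (map_mul q₁ a c) (map_mul q₂ b d), key _ a b rfl rfl,
        key _ c d rfl rfl, map_mul, map_mul]
      have h (u : A) (z : C) : p * (π u * z) = π u * (p * z) := by
        rw [← mul_assoc, hc, mul_assoc]
      have hpp (z : C) : p * (p * z) = p * z := by rw [← mul_assoc, hp]
      simp only [mul_add, add_mul, sub_mul, mul_sub, one_mul, mul_assoc, h, hpp]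
      abel
    map_add' := by
      rintro ⟨x₁, x₂⟩ ⟨y₁, y₂⟩
      obtain ⟨a, rfl⟩ := hq₁ x₁
      obtain ⟨b, rfl⟩ := hq₂ x₂
      obtain ⟨c, rfl⟩ := hq₁ y₁
      obtain ⟨d, rfl⟩ := hq₂ y₂
      rw [key _ (a + c) (b + d) (map_add q₁ a c) (map_add q₂ b d), key _ a b rfl rfl,
        key _ c d rfl rfl, map_add, map_add, mul_add, mul_add]
      abel
    commutes' := by
      intro r
      rw [key _ (algebraMap ℂ A r) (algebraMap ℂ A r) (AlgHomClass.commutes q₁ r)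
        (AlgHomClass.commutes q₂ r), ← add_mul, add_sub_cancel, one_mul, AlgHomClass.commutes]
    map_star' := by
      rintro ⟨x₁, x₂⟩
      obtain ⟨a, rfl⟩ := hq₁ x₁
      obtain ⟨b, rfl⟩ := hq₂ x₂
      rw [key _ (star a) (star b) (map_star q₁ a) (map_star q₂ b), key _ a b rfl rfl]
      simp only [star_add, star_mul, star_sub, star_one, hps, map_star]
      simp only [← map_star π, sub_mul, mul_sub, one_mul, mul_one, hc] }

theorem StarAlgHom.prodOfProjection_apply {A B₁ B₂ C : Type*}
    [Ring A] [StarRing A] [Algebra ℂ A] [Ring B₁] [StarRing B₁] [Algebra ℂ B₁]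
    [Ring B₂] [StarRing B₂] [Algebra ℂ B₂] [Ring C] [StarRing C] [Algebra ℂ C]
    (π : A →⋆ₐ[ℂ] C) (p : C) (hp : p * p = p) (hps : star p = p)
    (hc : ∀ a, p * π a = π a * p)
    (q₁ : A →⋆ₐ[ℂ] B₁) (hq₁ : Function.Surjective q₁)
    (q₂ : A →⋆ₐ[ℂ] B₂) (hq₂ : Function.Surjective q₂)
    (h₁ : ∀ a b, q₁ a = q₁ b → p * π a = p * π b)
    (h₂ : ∀ a b, q₂ a = q₂ b → (1 - p) * π a = (1 - p) * π b) (a b : A) :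
    prodOfProjection π p hp hps hc q₁ hq₁ q₂ hq₂ h₁ h₂ (q₁ a, q₂ b) =
      p * π a + (1 - p) * π b := by
  change p * π (Function.surjInv hq₁ (q₁ a)) + (1 - p) * π (Function.surjInv hq₂ (q₂ b)) = _
  rw [h₁ _ a (Function.surjInv_eq hq₁ _), h₂ _ b (Function.surjInv_eq hq₂ _)]

/-- Let `(π, U, H)` be a covariant representation of `(A, δ)`, let
`I = Ker δ` and `J = {a : U*U π(a) = π(a)}`.  Realize `A/I` and `A/J` as unital
C*-algebras `B₁`, `B₂` with surjective `*`-homomorphisms `q₁, q₂` having kernels `I`,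
`J`, so that `A_J = B₁ × B₂`, and let `δ_J` be the induced endomorphism of `A_J`.
Then the map `π̃(q₁ a, q₂ b) = U*U π(a) + (1 - U*U) π(b)` is a well-defined injective
`*`-homomorphism `A_J → B(H)` whose range is the C*-subalgebra generated by
`π(A) ∪ {U*U}`, the triple `(π̃, U, H)` is a covariant representation of `(A_J, δ_J)`,
and `π̃` is the unique extension of `π` with these properties. -/
theorem exists_unique_extension_of_covariantRep {A : Type*} [CStarAlgebra A]
    (δ : A →⋆ₙₐ[ℂ] A)
    {H : Type*} [NormedAddCommGroup H] [InnerProductSpace ℂ H] [CompleteSpace H]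
    (π : A →⋆ₐ[ℂ] (H →L[ℂ] H)) (U : H →L[ℂ] H)
    (hinj : Function.Injective π)
    (hU : U * star U * U = U)
    (hcov : ∀ a : A, U * π a * star U = π (δ a))
    (hcomm : ∀ a : A, star U * U * π a = π a * (star U * U))
    {B₁ : Type*} [CStarAlgebra B₁] {B₂ : Type*} [CStarAlgebra B₂]
    (q₁ : A →⋆ₐ[ℂ] B₁) (hq₁ : Function.Surjective q₁)
    (hker₁ : ∀ a : A, q₁ a = 0 ↔ δ a = 0)
    (q₂ : A →⋆ₐ[ℂ] B₂) (hq₂ : Function.Surjective q₂)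
    (hker₂ : ∀ a : A, q₂ a = 0 ↔ star U * U * π a = π a)
    (δJ : (B₁ × B₂) →⋆ₙₐ[ℂ] (B₁ × B₂))
    (hδJ : ∀ a b : A, δJ (q₁ a, q₂ b) = (q₁ (δ a), q₂ (δ a))) :
    ∃ πt : (B₁ × B₂) →⋆ₐ[ℂ] (H →L[ℂ] H),
      (∀ a b : A, πt (q₁ a, q₂ b) = star U * U * π a + (1 - star U * U) * π b) ∧
      Function.Injective πt ∧
      Set.range πt =
        ((StarAlgebra.adjoin ℂ (Set.range ⇑π ∪ {star U * U})).topologicalClosure :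
          Set (H →L[ℂ] H)) ∧
      (∀ a : A, πt (q₁ a, q₂ a) = π a) ∧
      (∀ x : B₁ × B₂, U * πt x * star U = πt (δJ x)) ∧
      (∀ x : B₁ × B₂, star U * U * πt x = πt x * (star U * U)) ∧
      (∀ ψ : (B₁ × B₂) →⋆ₐ[ℂ] (H →L[ℂ] H),
        Function.Injective ψ →
        Set.range ψ =
          ((StarAlgebra.adjoin ℂ (Set.range ⇑π ∪ {star U * U})).topologicalClosure :
            Set (H →L[ℂ] H)) →
        (∀ a : A, ψ (q₁ a, q₂ a) = π a) →
        (∀ x : B₁ × B₂, U * ψ x * star U = ψ (δJ x)) →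
        (∀ x : B₁ × B₂, star U * U * ψ x = ψ x * (star U * U)) →
        ψ = πt) := by
  obtain ⟨p, hpdef⟩ : ∃ p, p = star U * U := ⟨_, rfl⟩
  simp only [← hpdef] at hcomm hker₂ ⊢
  have hUp : U * p = U := by rw [hpdef, ← mul_assoc, hU]
  have hps : star p = p := by simp [hpdef]
  have hp : p * p = p := by
    nth_rewrite 1 [hpdef]
    rw [mul_assoc, hUp, hpdef]
  have compress (T : H →L[ℂ] H) (hT : p * T = T * p) : U * T * star U = 0 ↔ p * T = 0 := by
    constructor
    · intro h
      calc p * T = star U * (U * T * star U) * U := by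
            rw [show star U * (U * T * star U) * U = (star U * U) * T * (star U * U) by
              simp only [mul_assoc], ← hpdef, mul_assoc, ← hT, ← mul_assoc, hp]
        _ = 0 := by rw [h]; simp
    · intro h
      rw [← hUp, mul_assoc U p T, h]
      simp
  have hI (a : A) : q₁ a = 0 ↔ p * π a = 0 := by
    rw [hker₁, ← compress _ (hcomm a), hcov, map_eq_zero_iff π hinj]
  have hJ (a : A) : q₂ a = 0 ↔ (1 - p) * π a = 0 := by
    rw [hker₂, sub_mul, one_mul, sub_eq_zero, eq_comm]
  have h₁ (a b : A) (h : q₁ a = q₁ b) : p * π a = p * π b := by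
    rw [← sub_eq_zero, ← mul_sub, ← map_sub, ← hI, map_sub, h, sub_self]
  have h₂ (a b : A) (h : q₂ a = q₂ b) : (1 - p) * π a = (1 - p) * π b := by
    rw [← sub_eq_zero, ← mul_sub, ← map_sub, ← hJ, map_sub, h, sub_self]
  have hdisj (a : A) (ha₁ : q₁ a = 0) (ha₂ : q₂ a = 0) : a = 0 := by
    rw [hI] at ha₁
    rw [hker₂, ha₁] at ha₂
    exact (map_eq_zero_iff π hinj).1 ha₂.symm
  obtain ⟨πt, hπt⟩ : ∃ πt : (B₁ × B₂) →⋆ₐ[ℂ] (H →L[ℂ] H),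
      ∀ a b : A, πt (q₁ a, q₂ b) = p * π a + (1 - p) * π b :=
    ⟨_, StarAlgHom.prodOfProjection_apply π p hp hps hcomm q₁ hq₁ q₂ hq₂ h₁ h₂⟩
  have hp' : p * (1 - p) = 0 := by rw [mul_sub, mul_one, hp, sub_self]
  have hpπt (a b : A) : p * πt (q₁ a, q₂ b) = p * π a := by
    rw [hπt, mul_add, ← mul_assoc, ← mul_assoc, hp, hp', zero_mul, add_zero]
  have hπtinj : Function.Injective πt := by
    rw [injective_iff_map_eq_zero]
    rintro ⟨x₁, x₂⟩ hx
    obtain ⟨a, rfl⟩ := hq₁ x₁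
    obtain ⟨b, rfl⟩ := hq₂ x₂
    have ha : p * π a = 0 := by rw [← hpπt a b, hx, mul_zero]
    rw [hπt, ha, zero_add] at hx
    rw [Prod.mk_eq_zero]
    exact ⟨(hI a).2 ha, (hJ b).2 hx⟩
  have hext (a : A) : πt (q₁ a, q₂ a) = π a := by
    rw [hπt, ← add_mul, add_sub_cancel, one_mul]
  have hπtp : πt (1, 0) = p := by
    simpa using hπt 1 0
  refine ⟨πt, hπt, hπtinj, ?_, hext, ?_, ?_, ?_⟩
  · refine Set.Subset.antisymm ?_ ?_
    · rintro _ ⟨⟨x₁, x₂⟩, rfl⟩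
      obtain ⟨a, rfl⟩ := hq₁ x₁
      obtain ⟨b, rfl⟩ := hq₂ x₂
      apply StarSubalgebra.le_topologicalClosure
      have hmem (c : A) : π c ∈ StarAlgebra.adjoin ℂ (Set.range ⇑π ∪ {p}) :=
        StarAlgebra.subset_adjoin ℂ _ (Or.inl ⟨c, rfl⟩)
      have hpmem : p ∈ StarAlgebra.adjoin ℂ (Set.range ⇑π ∪ {p}) :=
        StarAlgebra.subset_adjoin ℂ _ (Or.inr rfl)
      change πt (q₁ a, q₂ b) ∈ _
      rw [hπt]
      exact add_mem (mul_mem hpmem (hmem a)) (mul_mem (sub_mem (one_mem _) hpmem) (hmem b))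
    · refine StarSubalgebra.topologicalClosure_minimal (t := πt.range) (StarAlgebra.adjoin_le ?_) ?_
      · rintro _ (⟨a, rfl⟩ | rfl)
        · exact ⟨_, hext a⟩
        · exact ⟨_, hπtp⟩
      · exact (NonUnitalStarAlgHom.isometry πt hπtinj).isClosedEmbedding.isClosed_range
  · rintro ⟨x₁, x₂⟩
    obtain ⟨a, rfl⟩ := hq₁ x₁
    obtain ⟨b, rfl⟩ := hq₂ x₂
    rw [hδJ, hext, ← hcov, ← hUp, mul_assoc U, hpπt, mul_assoc U p (π a)]
  · rintro ⟨x₁, x₂⟩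
    rw [← hπtp, ← map_mul, ← map_mul]
    simp
  · intro ψ hψinj hψrange hψext hψcov hψcomm
    have hδ0 : δJ (0, 1) = 0 := by
      simpa [Prod.mk_zero_zero] using hδJ 0 1
    have h01 : p * ψ (0, 1) = 0 := by
      rw [← compress _ (hψcomm _), hψcov, hδ0, map_zero]
    obtain ⟨⟨x₁, x₂⟩, hx⟩ : p ∈ Set.range ψ := by
      rw [hψrange]
      exact StarSubalgebra.le_topologicalClosure _
        (StarAlgebra.subset_adjoin ℂ _ (Or.inr rfl))
    obtain ⟨a, rfl⟩ := hq₁ x₁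
    have hx₂ : x₂ = 0 := by
      rw [← hx, ← map_mul, map_eq_zero_iff ψ hψinj] at h01
      simpa using h01
    subst hx₂
    have hδx : δJ (q₁ (1 - a), q₂ 1) = 0 := by
      rw [← map_eq_zero_iff ψ hψinj, ← hψcov,
        show ((q₁ (1 - a), q₂ 1) : B₁ × B₂) = 1 - (q₁ a, 0) by ext <;> simp, map_sub, hx,
        map_one, mul_sub, mul_one, hUp, sub_self, zero_mul]
    rw [hδJ, Prod.mk_eq_zero] at hδx
    have ha : q₁ a = 1 := by
      have := (hker₁ _).2 (hdisj _ hδx.1 hδx.2)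
      rw [map_sub, map_one, sub_eq_zero] at this
      exact this.symm
    rw [ha] at hx
    ext1 ⟨y₁, y₂⟩
    obtain ⟨c, rfl⟩ := hq₁ y₁
    obtain ⟨d, rfl⟩ := hq₂ y₂
    rw [hπt, ← hψext c, ← hψext d, ← hx, ← map_one ψ, ← map_sub, ← map_mul, ← map_mul, ← map_add]
    exact congrArg ψ (by ext <;> simp)
end

section
/- The set M(A), equipped with entrywise addition and scalar multiplication, the involution (a*)_{mn} = (a_{nm})*, and the convolution multiplication a ⋆ b = a·Σ_{j=0}^∞ Λ^j(b) + Σ_{j=1}^∞ Λ^j(a)·b, is an associative *-algebra; in particular the convolution is associative: (a ⋆ b) ⋆ c = a ⋆ (b ⋆ c) for all a, b, c ∈ M(A), and (a ⋆ b)* = b* ⋆ a*. -/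
open Filter Topology
open scoped NNReal

noncomputable section

variable {A : Type*} [CStarAlgebra A]

/-- The underlying set of the matrix algebra `M(A)`: matrices over `A` with finitely many
nonzero entries satisfying the entry condition `a_{ij} ∈ δ^i(1)·A·δ^j(1)`. -/
def MatMem (δ : A →⋆ₙₐ[ℂ] A) (a : ℕ → ℕ → A) : Prop :=
  ({p : ℕ × ℕ | a p.1 p.2 ≠ 0}).Finite ∧
    ∀ i j : ℕ, (⇑δ)^[i] 1 * a i j * (⇑δ)^[j] 1 = a i j

/-- The shift `Λ : Λ(a)_{ij} = δ(a_{i-1,j-1})` for `i, j ≥ 1`, and `0` otherwise. -/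
def lam (δ : A →⋆ₙₐ[ℂ] A) (a : ℕ → ℕ → A) : ℕ → ℕ → A :=
  fun i j => if i = 0 ∨ j = 0 then 0 else δ (a (i - 1) (j - 1))

/-- Ordinary (finitely supported) matrix multiplication. -/
def matMul (a b : ℕ → ℕ → A) : ℕ → ℕ → A := fun i k => ∑ᶠ j : ℕ, a i j * b j k

/-- The convolution multiplication `a ⋆ b = a·Σ_{j≥0} Λ^j(b) + Σ_{j≥1} Λ^j(a)·b`. -/
def conv (δ : A →⋆ₙₐ[ℂ] A) (a b : ℕ → ℕ → A) : ℕ → ℕ → A :=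
  fun i k => (∑ᶠ j : ℕ, matMul a ((lam δ)^[j] b) i k) +
    ∑ᶠ j : ℕ, matMul ((lam δ)^[j + 1] a) b i k

/-- The involution `(a*)_{mn} = (a_{nm})*`. -/
def mstar (a : ℕ → ℕ → A) : ℕ → ℕ → A := fun i j => star (a j i)

/-- The embedding of `A` into `M(A)` at the `(0,0)` entry. -/
def embed (a : A) : ℕ → ℕ → A := fun i j => if i = 0 ∧ j = 0 then a else 0

/-- The matrix `u`, having `δ(1)` at the `(0,1)` entry and zeros elsewhere. -/
def umat (δ : A →⋆ₙₐ[ℂ] A) : ℕ → ℕ → A := fun i j => if i = 0 ∧ j = 1 then δ 1 else 0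

/-- `⋆`-powers of a matrix (`mpow δ x 0` is the matrix unit `embed 1`). -/
def mpow (δ : A →⋆ₙₐ[ℂ] A) (x : ℕ → ℕ → A) : ℕ → ℕ → ℕ → A
  | 0 => embed 1
  | n + 1 => conv δ (mpow δ x n) x

/-- A matrix is `k`-diagonal if all entries away from the `k`-th diagonal vanish. -/
def IsDiag (k : ℤ) (a : ℕ → ℕ → A) : Prop :=
  ∀ i j : ℕ, a i j ≠ 0 → (j : ℤ) - (i : ℤ) = k

/-- The `n`-th entry `a_n^{(k)}` of the `k`-th diagonal of a matrix. -/
def diagEntry (a : ℕ → ℕ → A) (k : ℤ) (n : ℕ) : A :=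
  if 0 ≤ k then a n (n + k.toNat) else a (n + (-k).toNat) n

/-- `N_k` carries the `k`-th diagonal onto the `0`-th diagonal and deletes the rest. -/
def Nmat (a : ℕ → ℕ → A) (k : ℤ) : ℕ → ℕ → A :=
  fun i j => if i = j then diagEntry a k i else 0

variable {H : Type*} [NormedAddCommGroup H] [InnerProductSpace ℂ H] [CompleteSpace H]

/-- `(π, U, H)` is a covariant representation of `(A, δ)`. -/
def IsCovariantRep (δ : A →⋆ₙₐ[ℂ] A) (π : A →⋆ₐ[ℂ] (H →L[ℂ] H)) (U : H →L[ℂ] H) : Prop :=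
  Function.Injective π ∧ U * star U * U = U ∧
    (∀ a : A, U * π a * star U = π (δ a)) ∧
    (∀ a : A, star U * U * π a = π a * (star U * U))

/-- The map `Ψ_{(π,U)} : M(A) → B(H)`, `a ↦ Σ_{m,n} U^{*m} π(a_{mn}) U^n`. -/
def Psi (π : A →⋆ₐ[ℂ] (H →L[ℂ] H)) (U : H →L[ℂ] H) (a : ℕ → ℕ → A) : H →L[ℂ] H :=
  ∑ᶠ (m : ℕ) (n : ℕ), (star U) ^ m * π (a m n) * U ^ n

/-- Property `(*)` of a covariant representation. -/
def PropertyStar (δ : A →⋆ₙₐ[ℂ] A) (π : A →⋆ₐ[ℂ] (H →L[ℂ] H)) (U : H →L[ℂ] H) : Prop :=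
  ∀ a : ℕ → ℕ → A, MatMem δ a →
    ‖∑ᶠ m : ℕ, (star U) ^ m * π (a m m) * U ^ m‖ ≤ ‖Psi π U a‖

/-- The matrix with entry `x` at position `(i, j)` and zeros elsewhere. -/
def matSingle (i j : ℕ) (x : A) : ℕ → ℕ → A := fun p q => if p = i ∧ q = j then x else 0

theorem MatMem.zero (δ : A →⋆ₙₐ[ℂ] A) : MatMem δ (0 : ℕ → ℕ → A) := by
  constructor <;> simp

theorem MatMem.add {δ : A →⋆ₙₐ[ℂ] A} {a b : ℕ → ℕ → A} (ha : MatMem δ a) (hb : MatMem δ b) :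
    MatMem δ (a + b) := by
  refine ⟨(ha.1.union hb.1).subset fun p hp => ?_, fun i j => ?_⟩
  · by_contra h
    simp only [Set.mem_union, Set.mem_ofPred_eq, not_or, not_not] at h
    exact hp (by simp [h.1, h.2])
  · simp only [Pi.add_apply, mul_add, add_mul, ha.2, hb.2]

theorem MatMem.smul {δ : A →⋆ₙₐ[ℂ] A} (c : ℂ) {a : ℕ → ℕ → A} (ha : MatMem δ a) :
    MatMem δ (c • a) := by
  refine ⟨ha.1.subset fun p hp h => hp (by simp [h]), fun i j => ?_⟩
  simp only [Pi.smul_apply, mul_smul_comm, smul_mul_assoc, ha.2]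

theorem star_iterate_map (δ : A →⋆ₙₐ[ℂ] A) (n : ℕ) (x : A) :
    star ((⇑δ)^[n] x) = (⇑δ)^[n] (star x) := by
  induction n generalizing x with
  | zero => rfl
  | succ n ih => rw [Function.iterate_succ_apply, ih, Function.iterate_succ_apply, map_star]

theorem iterate_map_mul' (δ : A →⋆ₙₐ[ℂ] A) (n : ℕ) (x y : A) :
    (⇑δ)^[n] (x * y) = (⇑δ)^[n] x * (⇑δ)^[n] y :=
  iterate_map_mul δ n x y

theorem iterate_map_smul' (δ : A →⋆ₙₐ[ℂ] A) (n : ℕ) (z : ℂ) (x : A) :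
    (⇑δ)^[n] (z • x) = z • (⇑δ)^[n] x :=
  (Function.Commute.iterate_left (fun y => map_smul δ z y) n : Function.Commute _ (z • ·)) x

theorem MatMem.mstar {δ : A →⋆ₙₐ[ℂ] A} {a : ℕ → ℕ → A} (ha : MatMem δ a) :
    MatMem δ (mstar a) := by
  refine ⟨(ha.1.image Prod.swap).subset fun p hp => ⟨p.swap, ?_, by simp⟩, fun i j => ?_⟩
  · intro h
    exact hp (by simpa [_root_.mstar] using h)
  · have h := congrArg star (ha.2 j i)
    simpa [_root_.mstar, star_mul, star_iterate_map, mul_assoc] using h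

theorem MatMem.matSingle {δ : A →⋆ₙₐ[ℂ] A} {i j : ℕ} {x : A}
    (hx : (⇑δ)^[i] 1 * x * (⇑δ)^[j] 1 = x) : MatMem δ (matSingle i j x) := by
  refine ⟨(Set.finite_singleton (i, j)).subset fun p hp => ?_, fun p q => ?_⟩
  · by_contra h
    exact hp (if_neg fun hh => h (Prod.ext hh.1 hh.2))
  · unfold _root_.matSingle
    split_ifs with h
    · rw [h.1, h.2, hx]
    · simp

/-- Elements of `M(A)` are finite sums of single-entry elements of `M(A)`. -/
theorem MatMem.induction {δ : A →⋆ₙₐ[ℂ] A} {P : (a : ℕ → ℕ → A) → MatMem δ a → Prop}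
    (zero : P 0 (MatMem.zero δ))
    (single : ∀ i j x (hx : (⇑δ)^[i] 1 * x * (⇑δ)^[j] 1 = x),
      P (_root_.matSingle i j x) (MatMem.matSingle hx))
    (add : ∀ a b (ha : MatMem δ a) (hb : MatMem δ b), P a ha → P b hb → P (a + b) (ha.add hb))
    {a : ℕ → ℕ → A} (ha : MatMem δ a) : P a ha := by
  have key : ∀ s : Finset (ℕ × ℕ),
      ∃ h, P (∑ p ∈ s, _root_.matSingle p.1 p.2 (a p.1 p.2)) h := by
    intro s
    induction s using Finset.induction_on with
    | empty => exact ⟨MatMem.zero δ, zero⟩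
    | insert p s hp ih =>
      obtain ⟨h, ih⟩ := ih
      rw [Finset.sum_insert hp]
      exact ⟨_, add _ _ _ h (single _ _ _ (ha.2 p.1 p.2)) ih⟩
  have hsum : ∑ p ∈ ha.1.toFinset, _root_.matSingle p.1 p.2 (a p.1 p.2) = a := by
    funext i j
    rw [Finset.sum_apply, Finset.sum_apply, Finset.sum_eq_single (i, j)]
    · simp [_root_.matSingle]
    · intro p _ hp
      exact if_neg fun h => hp (Prod.ext h.1.symm h.2.symm)
    · intro h
      have : a i j = 0 := by simpa using h
      simp [_root_.matSingle, this]
  obtain ⟨_, h⟩ := hsum ▸ key ha.1.toFinset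
  exact h

section Shift

variable (δ : A →⋆ₙₐ[ℂ] A)

theorem lam_iterate_apply (n : ℕ) (a : ℕ → ℕ → A) (i j : ℕ) :
    (lam δ)^[n] a i j = if i < n ∨ j < n then 0 else (⇑δ)^[n] (a (i - n) (j - n)) := by
  induction n generalizing i j with
  | zero => simp
  | succ n ih =>
    rw [Function.iterate_succ_apply', Function.iterate_succ_apply', lam]
    rcases i with _ | i
    · simp
    rcases j with _ | j
    · simp
    simp only [Nat.add_eq_zero_iff, one_ne_zero, and_false, or_self, if_false,
      Nat.add_sub_cancel, ih, Nat.add_lt_add_iff_right, Nat.add_sub_add_right]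
    split_ifs <;> simp

theorem lam_iterate_add (n : ℕ) (a b : ℕ → ℕ → A) :
    (lam δ)^[n] (a + b) = (lam δ)^[n] a + (lam δ)^[n] b := by
  funext i j
  simp only [lam_iterate_apply, Pi.add_apply]
  split_ifs
  · simp
  · exact iterate_map_add δ n _ _

theorem lam_iterate_smul (n : ℕ) (z : ℂ) (a : ℕ → ℕ → A) :
    (lam δ)^[n] (z • a) = z • (lam δ)^[n] a := by
  funext i j
  simp only [lam_iterate_apply, Pi.smul_apply]
  split_ifs
  · simp
  · exact iterate_map_smul' δ n z _

theorem lam_iterate_matSingle (n i j : ℕ) (x : A) :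
    (lam δ)^[n] (matSingle i j x) = matSingle (i + n) (j + n) ((⇑δ)^[n] x) := by
  funext p q
  rw [lam_iterate_apply]
  simp only [matSingle]
  by_cases h : p = i + n ∧ q = j + n
  · obtain ⟨rfl, rfl⟩ := h
    simp
  · rw [if_neg h]
    split_ifs with h1 h2
    · rfl
    · omega
    · exact iterate_map_zero δ n

end Shift

theorem matMul_matSingle (i j k l : ℕ) (x y : A) :
    matMul (matSingle i j x) (matSingle k l y) = if j = k then matSingle i l (x * y) else 0 := by
  funext p q
  rw [matMul, finsum_eq_single _ j fun m hm => by simp [matSingle, hm]]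
  by_cases h : j = k <;> by_cases hp : p = i <;> by_cases hq : q = l <;>
    simp [matSingle, h, hp, hq]

section Finiteness

variable {δ : A →⋆ₙₐ[ℂ] A} {a b : ℕ → ℕ → A}

theorem MatMem.finite_mul_left (ha : MatMem δ a) (b : ℕ → ℕ → A) (i k : ℕ) :
    (Function.support fun j => a i j * b j k).Finite := by
  refine (ha.1.image Prod.snd).subset fun j hj => ⟨(i, j), fun h => hj ?_, rfl⟩
  simp only at h
  simp [h]

theorem MatMem.finite_mul_right (a : ℕ → ℕ → A) (hb : MatMem δ b) (i k : ℕ) :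
    (Function.support fun j => a i j * b j k).Finite := by
  refine (hb.1.image Prod.fst).subset fun j hj => ⟨(j, k), fun h => hj ?_, rfl⟩
  simp only at h
  simp [h]

theorem finite_matMul_lam_right (δ : A →⋆ₙₐ[ℂ] A) (a b : ℕ → ℕ → A) (i k : ℕ) :
    (Function.support fun j => matMul a ((lam δ)^[j] b) i k).Finite := by
  refine (Set.finite_Iic k).subset fun j hj => ?_
  by_contra h
  have h' : k < j := by simpa using h
  exact hj (by simp [matMul, lam_iterate_apply, h'])

theorem finite_matMul_lam_left (δ : A →⋆ₙₐ[ℂ] A) (a b : ℕ → ℕ → A) (i k : ℕ) :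
    (Function.support fun j => matMul ((lam δ)^[j + 1] a) b i k).Finite := by
  refine (Set.finite_Iic i).subset fun j hj => ?_
  by_contra h
  have h' : i < j + 1 := by
    simp only [Set.mem_Iic, not_le] at h
    omega
  exact hj (by simp [matMul, lam_iterate_apply, h'])

theorem MatMem.finite_lam_mul (ha : MatMem δ a) (b : ℕ → ℕ → A) (n i k : ℕ) :
    (Function.support fun j => (lam δ)^[n] a i j * b j k).Finite := by
  refine ((ha.1.image Prod.snd).image (· + n)).subset fun j hj => ?_
  have hn : ¬ (i < n ∨ j < n) := fun h => hj (by simp [lam_iterate_apply, h])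
  refine ⟨j - n, ⟨(i - n, j - n), fun h => hj ?_, rfl⟩, ?_⟩
  · simp only at h
    simp [lam_iterate_apply, h, iterate_map_zero]
  · simp only
    omega

theorem MatMem.finite_mul_lam (a : ℕ → ℕ → A) (hb : MatMem δ b) (n i k : ℕ) :
    (Function.support fun j => a i j * (lam δ)^[n] b j k).Finite := by
  refine ((hb.1.image Prod.fst).image (· + n)).subset fun j hj => ?_
  have hn : ¬ (j < n ∨ k < n) := fun h => hj (by simp [lam_iterate_apply, h])
  refine ⟨j - n, ⟨(j - n, k - n), fun h => hj ?_, rfl⟩, ?_⟩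
  · simp only at h
    simp [lam_iterate_apply, h, iterate_map_zero]
  · simp only
    omega

end Finiteness

section Conv

variable {δ : A →⋆ₙₐ[ℂ] A}

theorem conv_add_left {a b c : ℕ → ℕ → A} (ha : MatMem δ a) (hb : MatMem δ b) :
    conv δ (a + b) c = conv δ a c + conv δ b c := by
  funext i k
  have h1 (j : ℕ) : matMul (a + b) ((lam δ)^[j] c) i k =
      matMul a ((lam δ)^[j] c) i k + matMul b ((lam δ)^[j] c) i k := by
    simp only [matMul, Pi.add_apply, add_mul]
    exact finsum_add_distrib (ha.finite_mul_left _ i k) (hb.finite_mul_left _ i k)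
  have h2 (j : ℕ) : matMul ((lam δ)^[j + 1] (a + b)) c i k =
      matMul ((lam δ)^[j + 1] a) c i k + matMul ((lam δ)^[j + 1] b) c i k := by
    simp only [matMul, lam_iterate_add, Pi.add_apply, add_mul]
    exact finsum_add_distrib (ha.finite_lam_mul _ _ i k) (hb.finite_lam_mul _ _ i k)
  simp only [conv, Pi.add_apply, h1, h2]
  rw [finsum_add_distrib (finite_matMul_lam_right δ a c i k) (finite_matMul_lam_right δ b c i k),
    finsum_add_distrib (finite_matMul_lam_left δ a c i k) (finite_matMul_lam_left δ b c i k)]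
  abel

theorem conv_add_right {a b c : ℕ → ℕ → A} (hb : MatMem δ b) (hc : MatMem δ c) :
    conv δ a (b + c) = conv δ a b + conv δ a c := by
  funext i k
  have h1 (j : ℕ) : matMul a ((lam δ)^[j] (b + c)) i k =
      matMul a ((lam δ)^[j] b) i k + matMul a ((lam δ)^[j] c) i k := by
    simp only [matMul, lam_iterate_add, Pi.add_apply, mul_add]
    exact finsum_add_distrib (hb.finite_mul_lam _ _ i k) (hc.finite_mul_lam _ _ i k)
  have h2 (j : ℕ) : matMul ((lam δ)^[j + 1] a) (b + c) i k =
      matMul ((lam δ)^[j + 1] a) b i k + matMul ((lam δ)^[j + 1] a) c i k := by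
    simp only [matMul, Pi.add_apply, mul_add]
    exact finsum_add_distrib (hb.finite_mul_right _ i k) (hc.finite_mul_right _ i k)
  simp only [conv, Pi.add_apply, h1, h2]
  rw [finsum_add_distrib (finite_matMul_lam_right δ a b i k) (finite_matMul_lam_right δ a c i k),
    finsum_add_distrib (finite_matMul_lam_left δ a b i k) (finite_matMul_lam_left δ a c i k)]
  abel

theorem conv_smul_left (z : ℂ) (a b : ℕ → ℕ → A) : conv δ (z • a) b = z • conv δ a b := by
  funext i k
  simp only [conv, matMul, lam_iterate_smul, Pi.smul_apply, smul_mul_assoc, ← smul_finsum,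
    smul_add]

theorem conv_smul_right (z : ℂ) (a b : ℕ → ℕ → A) : conv δ a (z • b) = z • conv δ a b := by
  funext i k
  simp only [conv, matMul, lam_iterate_smul, Pi.smul_apply, mul_smul_comm, ← smul_finsum,
    smul_add]

theorem conv_zero_left (a : ℕ → ℕ → A) : conv δ 0 a = 0 := by
  simpa using conv_smul_left (δ := δ) 0 0 a

theorem conv_zero_right (a : ℕ → ℕ → A) : conv δ a 0 = 0 := by
  simpa using conv_smul_right (δ := δ) 0 a 0

theorem conv_matSingle_add_left (i k l d : ℕ) (x y : A) :
    conv δ (matSingle i (k + d) x) (matSingle k l y) =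
      matSingle i (l + d) (x * (⇑δ)^[d] y) := by
  funext p q
  simp only [conv, lam_iterate_matSingle, matMul_matSingle]
  rw [finsum_eq_single _ d fun m hm => by rw [if_neg (by omega)]; rfl]
  have h (m : ℕ) : ¬ k + d + (m + 1) = k := by omega
  simp [h]

theorem conv_matSingle_add_right (i j l d : ℕ) (x y : A) :
    conv δ (matSingle i j x) (matSingle (j + d) l y) =
      matSingle (i + d) l ((⇑δ)^[d] x * y) := by
  rcases d with _ | d
  · simpa using conv_matSingle_add_left (δ := δ) i j l 0 x y
  funext p q
  simp only [conv, lam_iterate_matSingle, matMul_matSingle]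
  have h (m : ℕ) : ¬ j = j + (d + 1) + m := by omega
  rw [finsum_eq_single (fun m => (if j + (m + 1) = _ then _ else _ : ℕ → ℕ → A) p q) d
    fun m hm => by rw [if_neg (by omega)]; rfl]
  simp [h]

theorem MatMem.conv {a b : ℕ → ℕ → A} (ha : MatMem δ a) (hb : MatMem δ b) :
    MatMem δ (conv δ a b) := by
  induction ha using MatMem.induction with
  | zero => simpa [conv_zero_left] using MatMem.zero δ
  | add a a' ha ha' h h' => simpa [conv_add_left ha ha'] using h.add h'
  | single i j x hx =>
  induction hb using MatMem.induction with
  | zero => simpa [conv_zero_right] using MatMem.zero δ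
  | add b b' hb hb' h h' => simpa [conv_add_right hb hb'] using h.add h'
  | single k l y hy =>
  have one_one (n : ℕ) : (⇑δ)^[n] 1 * (⇑δ)^[n] 1 = (⇑δ)^[n] 1 := by
    rw [← iterate_map_mul', one_mul]
  have hx' : (⇑δ)^[i] 1 * x = x := by
    rw [← hx, ← mul_assoc, ← mul_assoc, one_one]
  have hy' : y * (⇑δ)^[l] 1 = y := by
    rw [← hy, mul_assoc, one_one]
  rcases le_total k j with h | h <;> obtain ⟨d, rfl⟩ := Nat.exists_eq_add_of_le h
  · rw [conv_matSingle_add_left]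
    apply MatMem.matSingle
    rw [add_comm l d, Function.iterate_add_apply, ← mul_assoc, hx', mul_assoc,
      ← iterate_map_mul', hy']
  · rw [conv_matSingle_add_right]
    apply MatMem.matSingle
    rw [add_comm i d, Function.iterate_add_apply, ← mul_assoc, ← iterate_map_mul', hx',
      mul_assoc, hy']

theorem conv_assoc_matSingle (i j k l m n : ℕ) (x y z : A) :
    conv δ (conv δ (matSingle i j x) (matSingle k l y)) (matSingle m n z) =
      conv δ (matSingle i j x) (conv δ (matSingle k l y) (matSingle m n z)) := by
  rcases le_total k j with h | h <;> obtain ⟨d, rfl⟩ := Nat.exists_eq_add_of_le h <;>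
    rcases le_total m l with h' | h' <;> obtain ⟨e, rfl⟩ := Nat.exists_eq_add_of_le h'
  · rw [conv_matSingle_add_left, conv_matSingle_add_left, conv_matSingle_add_left,
      add_assoc m e d, conv_matSingle_add_left, iterate_map_mul', add_comm e d,
      Function.iterate_add_apply, mul_assoc, add_assoc, add_comm e d]
  · rw [conv_matSingle_add_left, conv_matSingle_add_right]
    rcases le_total e d with g | g <;> obtain ⟨f, rfl⟩ := Nat.exists_eq_add_of_le g
    · rw [← add_assoc, conv_matSingle_add_left, ← add_assoc, conv_matSingle_add_left,
        iterate_map_mul', add_comm e f, Function.iterate_add_apply, mul_assoc]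
    · rw [← add_assoc, conv_matSingle_add_right, ← add_assoc, conv_matSingle_add_right,
        iterate_map_mul', add_comm d f, Function.iterate_add_apply, mul_assoc]
  · rw [conv_matSingle_add_right, conv_matSingle_add_left, conv_matSingle_add_left,
      conv_matSingle_add_right, mul_assoc]
  · rw [conv_matSingle_add_right, conv_matSingle_add_right, conv_matSingle_add_right,
      add_assoc j d e, conv_matSingle_add_right, iterate_map_mul', add_comm d e,
      Function.iterate_add_apply, mul_assoc, add_assoc, add_comm d e]

theorem conv_assoc {a b c : ℕ → ℕ → A} (ha : MatMem δ a) (hb : MatMem δ b) (hc : MatMem δ c) :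
    conv δ (conv δ a b) c = conv δ a (conv δ b c) := by
  induction ha using MatMem.induction with
  | zero => simp only [conv_zero_left]
  | add a a' ha ha' h h' =>
    rw [conv_add_left ha ha', conv_add_left (ha.conv hb) (ha'.conv hb), conv_add_left ha ha', h, h']
  | single i j x hx =>
  have ha := MatMem.matSingle hx
  induction hb using MatMem.induction with
  | zero => simp only [conv_zero_left, conv_zero_right]
  | add b b' hb hb' h h' =>
    rw [conv_add_right hb hb', conv_add_left (ha.conv hb) (ha.conv hb'), conv_add_left hb hb',
      conv_add_right (hb.conv hc) (hb'.conv hc), h, h']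
  | single k l y hy =>
  have hb := MatMem.matSingle hy
  induction hc using MatMem.induction with
  | zero => simp only [conv_zero_right]
  | add c c' hc hc' h h' =>
    rw [conv_add_right hc hc', conv_add_right hc hc', conv_add_right (hb.conv hc) (hb.conv hc'),
      h, h']
  | single m n z hz => exact conv_assoc_matSingle i j k l m n x y z

end Conv

theorem mstar_add (a b : ℕ → ℕ → A) : mstar (a + b) = mstar a + mstar b := by
  funext i j
  simp [mstar]

theorem mstar_zero : mstar (0 : ℕ → ℕ → A) = 0 := by
  funext i j
  simp [mstar]

theorem mstar_matSingle (i j : ℕ) (x : A) :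
    mstar (matSingle i j x) = matSingle j i (star x) := by
  funext p q
  simp only [mstar, matSingle, apply_ite star, star_zero, and_comm]

theorem mstar_conv {δ : A →⋆ₙₐ[ℂ] A} {a b : ℕ → ℕ → A} (ha : MatMem δ a) (hb : MatMem δ b) :
    mstar (conv δ a b) = conv δ (mstar b) (mstar a) := by
  induction ha using MatMem.induction with
  | zero => simp only [conv_zero_left, mstar_zero, conv_zero_right]
  | add a a' ha ha' h h' =>
    rw [conv_add_left ha ha', mstar_add, mstar_add, conv_add_right ha.mstar ha'.mstar, h, h']
  | single i j x hx =>
  induction hb using MatMem.induction with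
  | zero => simp only [conv_zero_left, mstar_zero, conv_zero_right]
  | add b b' hb hb' h h' =>
    rw [conv_add_right hb hb', mstar_add, mstar_add, conv_add_left hb.mstar hb'.mstar, h, h']
  | single k l y hy =>
  rcases le_total k j with h | h <;> obtain ⟨d, rfl⟩ := Nat.exists_eq_add_of_le h
  · simp only [conv_matSingle_add_left, mstar_matSingle, conv_matSingle_add_right, star_mul,
      star_iterate_map]
  · simp only [conv_matSingle_add_left, mstar_matSingle, conv_matSingle_add_right, star_mul,
      star_iterate_map]

/-- `M(A)`, with entrywise addition and scalar multiplication, the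
involution `(a*)_{mn} = (a_{nm})*` and the convolution multiplication `⋆`, is an
associative `*`-algebra; in particular `⋆` is associative and `(a ⋆ b)* = b* ⋆ a*`. -/
theorem matAlg_is_star_algebra {A : Type*} [CStarAlgebra A] (δ : A →⋆ₙₐ[ℂ] A) :
    (∀ a b : ℕ → ℕ → A, MatMem δ a → MatMem δ b → MatMem δ (a + b)) ∧
    (∀ (c : ℂ) (a : ℕ → ℕ → A), MatMem δ a → MatMem δ (c • a)) ∧
    (∀ a : ℕ → ℕ → A, MatMem δ a → MatMem δ (mstar a)) ∧
    (∀ a b : ℕ → ℕ → A, MatMem δ a → MatMem δ b → MatMem δ (conv δ a b)) ∧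
    (∀ a b c : ℕ → ℕ → A, MatMem δ a → MatMem δ b → MatMem δ c →
      conv δ (conv δ a b) c = conv δ a (conv δ b c)) ∧
    (∀ a b c : ℕ → ℕ → A, MatMem δ a → MatMem δ b → MatMem δ c →
      conv δ (a + b) c = conv δ a c + conv δ b c ∧
      conv δ a (b + c) = conv δ a b + conv δ a c) ∧
    (∀ (z : ℂ) (a b : ℕ → ℕ → A), MatMem δ a → MatMem δ b →
      conv δ (z • a) b = z • conv δ a b ∧ conv δ a (z • b) = z • conv δ a b) ∧
    (∀ a : ℕ → ℕ → A, mstar (mstar a) = a) ∧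
    (∀ a b : ℕ → ℕ → A, mstar (a + b) = mstar a + mstar b) ∧
    (∀ (z : ℂ) (a : ℕ → ℕ → A), mstar (z • a) = (starRingEnd ℂ z) • mstar a) ∧
    (∀ a b : ℕ → ℕ → A, MatMem δ a → MatMem δ b →
      mstar (conv δ a b) = conv δ (mstar b) (mstar a)) := by
  refine ⟨fun _ _ ha hb => ha.add hb, fun c _ ha => ha.smul c, fun _ ha => ha.mstar,
    fun _ _ ha hb => ha.conv hb, fun _ _ _ ha hb hc => conv_assoc ha hb hc,
    fun _ _ _ ha hb hc => ⟨conv_add_left ha hb, conv_add_right hb hc⟩,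
    fun z a b _ _ => ⟨conv_smul_left z a b, conv_smul_right z a b⟩,
    fun a => ?_, mstar_add, fun z a => ?_, fun _ _ ha hb => mstar_conv ha hb⟩ <;>
  · funext i j
    simp [mstar]
end
end

section
/- The spaces M_k of k-diagonal matrices define a ℤ-graded *-algebra structure on M(A): M(A) = ⊕_{k∈ℤ} M_k as a linear space, and for all k, l ∈ ℤ one has (M_k)* = M_{−k} and M_k ⋆ M_l ⊆ M_{k+l}. Moreover M_0 is a *-subalgebra, M_k ⋆ M_{−k} is a self-adjoint two-sided ideal in M_0, M_k ⋆ (M_k)* ⋆ M_k = M_k, and M_k ⋆ (M_k)* ⋆ M_l ⋆ (M_l)* = M_l ⋆ (M_l)* ⋆ M_k ⋆ (M_k)*. -/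
open Filter Topology
open scoped NNReal

noncomputable section

variable {A : Type*} [CStarAlgebra A]

variable {H : Type*} [NormedAddCommGroup H] [InnerProductSpace ℂ H] [CompleteSpace H]

/-- The `k`-diagonal part of a matrix. -/
def diagPart (k : ℤ) (a : ℕ → ℕ → A) : ℕ → ℕ → A :=
  fun i j => if (j : ℤ) - (i : ℤ) = k then a i j else 0

/-- The space `M_k` of `k`-diagonal matrices of `M(A)`. -/
def Mdiag (δ : A →⋆ₙₐ[ℂ] A) (k : ℤ) : Set (ℕ → ℕ → A) :=
  {a | MatMem δ a ∧ IsDiag k a}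

/-- The product of two subsets of `M(A)` (finite sums of `⋆`-products). -/
def prodSet (δ : A →⋆ₙₐ[ℂ] A) (S T : Set (ℕ → ℕ → A)) : Set (ℕ → ℕ → A) :=
  (AddSubmonoid.closure {c | ∃ a ∈ S, ∃ b ∈ T, c = conv δ a b} : Set (ℕ → ℕ → A))

namespace MatAlg

section Unit

variable (δ : A →⋆ₙₐ[ℂ] A)

lemma iterate_mul (n : ℕ) (x y : A) : (⇑δ)^[n] (x * y) = (⇑δ)^[n] x * (⇑δ)^[n] y :=
  Function.Semiconj₂.iterate (fun a b => map_mul δ a b) n x y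

lemma iterate_add (n : ℕ) (x y : A) : (⇑δ)^[n] (x + y) = (⇑δ)^[n] x + (⇑δ)^[n] y :=
  Function.Semiconj₂.iterate (fun a b => map_add δ a b) n x y

lemma iterate_zero (n : ℕ) : (⇑δ)^[n] (0 : A) = 0 :=
  Function.iterate_fixed (map_zero δ) n

lemma iterate_star (n : ℕ) (x : A) : (⇑δ)^[n] (star x) = star ((⇑δ)^[n] x) :=
  (Function.Commute.iterate_left (f := ⇑δ) (g := star) (fun a => map_star δ a) n) x

lemma unit_mul_unit {i j : ℕ} (h : i ≤ j) :
    (⇑δ)^[i] (1 : A) * (⇑δ)^[j] 1 = (⇑δ)^[j] 1 := by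
  obtain ⟨s, rfl⟩ := Nat.exists_eq_add_of_le h
  rw [Function.iterate_add_apply, ← iterate_mul, one_mul]

lemma unit_mul_unit' {i j : ℕ} (h : i ≤ j) :
    (⇑δ)^[j] (1 : A) * (⇑δ)^[i] 1 = (⇑δ)^[j] 1 := by
  obtain ⟨s, rfl⟩ := Nat.exists_eq_add_of_le h
  rw [Function.iterate_add_apply, ← iterate_mul, mul_one]

/-- The corner `δ^i(1)·A·δ^j(1)`. -/
def corner (i j : ℕ) : AddSubmonoid A where
  carrier := {x | (⇑δ)^[i] 1 * x * (⇑δ)^[j] 1 = x}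
  zero_mem' := by simp
  add_mem' {x y} hx hy := by
    simp only [Set.mem_ofPred_eq] at *
    rw [mul_add, add_mul, hx, hy]

variable {δ}

lemma mem_corner {i j : ℕ} {x : A} :
    x ∈ corner δ i j ↔ (⇑δ)^[i] 1 * x * (⇑δ)^[j] 1 = x := Iff.rfl

lemma unit_mul_of_mem {i j : ℕ} {x : A} (h : x ∈ corner δ i j) : (⇑δ)^[i] 1 * x = x := by
  rw [mem_corner] at h
  rw [← h, ← mul_assoc, ← mul_assoc, unit_mul_unit δ le_rfl]

lemma mul_unit_of_mem {i j : ℕ} {x : A} (h : x ∈ corner δ i j) : x * (⇑δ)^[j] 1 = x := by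
  rw [mem_corner] at h
  rw [← h, mul_assoc, unit_mul_unit δ le_rfl]

lemma mem_corner_of {i j : ℕ} {x : A} (h : (⇑δ)^[i] 1 * x = x) (h' : x * (⇑δ)^[j] 1 = x) :
    x ∈ corner δ i j := by
  rw [mem_corner, h, h']

lemma mul_mem_corner {i m n j : ℕ} {x y : A} (hx : x ∈ corner δ i m) (hy : y ∈ corner δ n j) :
    x * y ∈ corner δ i j :=
  mem_corner_of (by rw [← mul_assoc, unit_mul_of_mem hx]) (by rw [mul_assoc, mul_unit_of_mem hy])

lemma corner_mono {i i' j j' : ℕ} (hi : i' ≤ i) (hj : j' ≤ j) {x : A}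
    (hx : x ∈ corner δ i j) : x ∈ corner δ i' j' :=
  mem_corner_of
    (by rw [← unit_mul_of_mem hx, ← mul_assoc, unit_mul_unit δ hi])
    (by rw [← mul_unit_of_mem hx, mul_assoc, unit_mul_unit' δ hj])

lemma unit_mem_corner (j : ℕ) : (⇑δ)^[j] 1 ∈ corner δ j j :=
  mem_corner_of (unit_mul_unit δ le_rfl) (unit_mul_unit δ le_rfl)

lemma star_mem_corner {i j : ℕ} {x : A} (hx : x ∈ corner δ i j) : star x ∈ corner δ j i := by
  have h := congrArg star (mem_corner.1 hx)
  simpa [mem_corner, ← iterate_star, mul_assoc] using h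

lemma iterate_mem_corner (s : ℕ) {i j : ℕ} {x : A} (hx : x ∈ corner δ i j) :
    (⇑δ)^[s] x ∈ corner δ (i + s) (j + s) := by
  rw [mem_corner, add_comm i, add_comm j, Function.iterate_add_apply,
    Function.iterate_add_apply, ← iterate_mul, ← iterate_mul, mem_corner.1 hx]

end Unit

section Space

variable (δ : A →⋆ₙₐ[ℂ] A)

lemma lam_iterate (s : ℕ) (a : ℕ → ℕ → A) (i j : ℕ) :
    (lam δ)^[s] a i j = if s ≤ i ∧ s ≤ j then (⇑δ)^[s] (a (i - s) (j - s)) else 0 := by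
  induction s generalizing i j with
  | zero => simp
  | succ s ih =>
    rw [Function.iterate_succ_apply', lam]
    rcases i with _ | i
    · simp
    rcases j with _ | j
    · simp
    simp only [Nat.add_eq_zero_iff, one_ne_zero, and_false, or_self, if_false,
      Nat.add_sub_cancel, ih, Nat.add_le_add_iff_right, Nat.add_sub_add_right]
    split_ifs
    · rw [Function.iterate_succ_apply']
    · simp

/-- Finitely supported matrices with `(i, j)` entry in `S i j`. -/
def matSpace (S : ℕ → ℕ → AddSubmonoid A) : AddSubmonoid (ℕ → ℕ → A) where
  carrier := {a | ({p : ℕ × ℕ | a p.1 p.2 ≠ 0}).Finite ∧ ∀ i j, a i j ∈ S i j}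
  zero_mem' := ⟨by simp, fun i j => (S i j).zero_mem⟩
  add_mem' {a b} ha hb := by
    refine ⟨(ha.1.union hb.1).subset fun p hp => ?_,
      fun i j => (S i j).add_mem (ha.2 i j) (hb.2 i j)⟩
    by_contra h
    simp only [Set.mem_union, Set.mem_ofPred_eq, not_or, not_not] at h
    simp [h.1, h.2] at hp

variable {δ}

lemma conv_entry_mem {S T R : ℕ → ℕ → AddSubmonoid A} {a b : ℕ → ℕ → A}
    (ha : ∀ i j, a i j ∈ S i j) (hb : ∀ i j, b i j ∈ T i j)
    (h₁ : ∀ i m n s x y, x ∈ S i (m + s) → y ∈ T m n → x * (⇑δ)^[s] y ∈ R i (n + s))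
    (h₂ : ∀ i m n s x y, x ∈ S i m → y ∈ T (m + s) n → (⇑δ)^[s] x * y ∈ R (i + s) n)
    (i j : ℕ) : conv δ a b i j ∈ R i j := by
  refine add_mem ?_ ?_
  · refine finsum_induction (· ∈ R i j) (zero_mem _) (fun _ _ => add_mem) fun s => ?_
    refine finsum_induction (· ∈ R i j) (zero_mem _) (fun _ _ => add_mem) fun m => ?_
    rw [lam_iterate]
    split_ifs with h
    · have := h₁ i (m - s) (j - s) s (a i m) (b (m - s) (j - s))
        (by rw [Nat.sub_add_cancel h.1]; exact ha _ _) (hb _ _)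
      rwa [Nat.sub_add_cancel h.2] at this
    · simp
  · refine finsum_induction (· ∈ R i j) (zero_mem _) (fun _ _ => add_mem) fun s => ?_
    refine finsum_induction (· ∈ R i j) (zero_mem _) (fun _ _ => add_mem) fun m => ?_
    rw [lam_iterate]
    split_ifs with h
    · have := h₂ (i - (s + 1)) (m - (s + 1)) j (s + 1) (a (i - (s + 1)) (m - (s + 1))) (b m j)
        (ha _ _) (by rw [Nat.sub_add_cancel h.2]; exact hb _ _)
      rwa [Nat.sub_add_cancel h.1] at this
    · simp

lemma exists_bound {a : ℕ → ℕ → A} (ha : ({p : ℕ × ℕ | a p.1 p.2 ≠ 0}).Finite) :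
    ∃ N, ∀ i j, a i j ≠ 0 → i < N ∧ j < N := by
  obtain ⟨M, hM⟩ := ha.bddAbove
  exact ⟨M.1 + M.2 + 1, fun i j h => by
    have := @hM (i, j) h
    obtain ⟨h₁, h₂⟩ := Prod.mk_le_mk.1 this
    omega⟩

lemma finite_of_bound {a : ℕ → ℕ → A} (N : ℕ) (h : ∀ i j, a i j ≠ 0 → i < N ∧ j < N) :
    ({p : ℕ × ℕ | a p.1 p.2 ≠ 0}).Finite :=
  ((Set.finite_Iio N).prod (Set.finite_Iio N)).subset fun p hp => h p.1 p.2 hp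

lemma conv_finite {a b : ℕ → ℕ → A} (ha : ({p : ℕ × ℕ | a p.1 p.2 ≠ 0}).Finite)
    (hb : ({p : ℕ × ℕ | b p.1 p.2 ≠ 0}).Finite) :
    ({p : ℕ × ℕ | conv δ a b p.1 p.2 ≠ 0}).Finite := by
  obtain ⟨N, hN⟩ := exists_bound ha
  obtain ⟨M, hM⟩ := exists_bound hb
  let B (K : ℕ) (i j : ℕ) : AddSubmonoid A :=
    { carrier := {x | x ≠ 0 → i < K ∧ j < K}
      zero_mem' := fun h => absurd rfl h
      add_mem' := fun {x y} hx hy h => by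
        by_cases h0 : x = 0
        · exact hy (by simpa [h0] using h)
        · exact hx h0 }
  refine finite_of_bound (N + M) fun i j => conv_entry_mem (S := B N) (T := B M)
    (R := B (N + M)) hN hM ?_ ?_ i j
  · intro i m n s x y hx hy h
    have h₁ := hx (left_ne_zero_of_mul h)
    have h₂ := hy (fun h0 => right_ne_zero_of_mul h (by rw [h0, iterate_zero]))
    omega
  · intro i m n s x y hx hy h
    have h₁ := hy (right_ne_zero_of_mul h)
    have h₂ := hx (fun h0 => left_ne_zero_of_mul h (by rw [h0, iterate_zero]))
    omega

/-- The matrix with `x` at the `(i, j)` entry and zeros elsewhere. -/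
def single (i j : ℕ) : A →+ (ℕ → ℕ → A) where
  toFun x := fun i' j' => if i' = i ∧ j' = j then x else 0
  map_zero' := by ext; simp
  map_add' x y := by
    ext i' j'
    simp only [Pi.add_apply]
    split_ifs <;> simp

lemma single_apply (i j i' j' : ℕ) (x : A) :
    single i j x i' j' = if i' = i ∧ j' = j then x else 0 := rfl

lemma single_mem {S : ℕ → ℕ → AddSubmonoid A} {i j : ℕ} {x : A} (hx : x ∈ S i j) :
    single i j x ∈ matSpace S := by
  refine ⟨(Set.finite_singleton (i, j)).subset fun p hp => ?_, fun i' j' => ?_⟩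
  · by_contra h
    exact hp (if_neg fun h' => h (Prod.ext h'.1 h'.2))
  · rw [single_apply]
    split_ifs with h
    · rwa [h.1, h.2]
    · exact zero_mem _

lemma eq_sum_single {a : ℕ → ℕ → A} (ha : ({p : ℕ × ℕ | a p.1 p.2 ≠ 0}).Finite) :
    a = ∑ p ∈ ha.toFinset, single p.1 p.2 (a p.1 p.2) := by
  ext i j
  rw [Finset.sum_apply, Finset.sum_apply]
  by_cases h : a i j = 0
  · rw [h, Finset.sum_eq_zero]
    intro p _
    rw [single_apply]
    split_ifs with h'
    · rw [← h'.1, ← h'.2, h]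
    · rfl
  · rw [Finset.sum_eq_single (i, j)]
    · simp [single_apply]
    · intro p _ hp
      rw [single_apply, if_neg]
      rintro ⟨rfl, rfl⟩
      exact hp rfl
    · intro h'
      simp [h] at h'

lemma conv_single (i m n : ℕ) (x y : A) :
    conv δ (single i m x) (single m n y) = single i n (x * y) := by
  ext i' n'
  have h₁ : ∀ s, s ≠ 0 → matMul (single i m x) ((lam δ)^[s] (single m n y)) i' n' = 0 := by
    intro s hs
    refine finsum_eq_zero_of_forall_eq_zero fun m' => ?_
    rw [lam_iterate, single_apply, single_apply]
    by_cases h : m' = m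
    · subst h
      split_ifs <;> first | omega | simp
    · simp [h]
  have h₂ : ∀ s, matMul ((lam δ)^[s + 1] (single i m x)) (single m n y) i' n' = 0 := by
    intro s
    refine finsum_eq_zero_of_forall_eq_zero fun m' => ?_
    rw [lam_iterate, single_apply, single_apply]
    by_cases h : m' = m
    · subst h
      split_ifs <;> first | omega | simp
    · simp [h]
  rw [conv, finsum_eq_single _ 0 h₁, finsum_eq_zero_of_forall_eq_zero h₂, add_zero,
    Function.iterate_zero, id_eq, matMul, finsum_eq_single _ m]
  · simp only [single_apply, and_true, true_and]
    split_ifs <;> simp_all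
  · intro m' hm'
    simp [single_apply, hm']

/-- The entrywise product of two families of additive submonoids, as for matrices. -/
def mulFam (S T : ℕ → ℕ → AddSubmonoid A) (i j : ℕ) : AddSubmonoid A :=
  AddSubmonoid.closure {z | ∃ m, ∃ x ∈ S i m, ∃ y ∈ T m j, x * y = z}

lemma mul_mem_mulFam {S T : ℕ → ℕ → AddSubmonoid A} {i m j : ℕ} {x y : A}
    (hx : x ∈ S i m) (hy : y ∈ T m j) : x * y ∈ mulFam S T i j :=
  AddSubmonoid.subset_closure ⟨m, x, hx, y, hy, rfl⟩

lemma mulFam_le {S T R : ℕ → ℕ → AddSubmonoid A}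
    (h : ∀ i m j, ∀ x ∈ S i m, ∀ y ∈ T m j, x * y ∈ R i j) : mulFam S T ≤ R := by
  intro i j
  refine (AddSubmonoid.closure_le).2 ?_
  rintro _ ⟨m, x, hx, y, hy, rfl⟩
  exact h i m j x hx y hy

lemma mulFam_mono {S S' T T' : ℕ → ℕ → AddSubmonoid A} (hS : S ≤ S') (hT : T ≤ T') :
    mulFam S T ≤ mulFam S' T' :=
  mulFam_le fun i m j _ hx _ hy => mul_mem_mulFam (hS i m hx) (hT m j hy)

lemma mulFam_assoc (S T R : ℕ → ℕ → AddSubmonoid A) :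
    mulFam (mulFam S T) R = mulFam S (mulFam T R) := by
  apply le_antisymm
  · refine mulFam_le fun i m j z hz r hr => ?_
    induction hz using AddSubmonoid.closure_induction with
    | mem z h =>
      obtain ⟨l, x, hx, y, hy, rfl⟩ := h
      rw [mul_assoc]
      exact mul_mem_mulFam hx (mul_mem_mulFam hy hr)
    | zero => simp
    | add _ _ _ _ h₁ h₂ => rw [add_mul]; exact add_mem h₁ h₂
  · refine mulFam_le fun i m j r hr z hz => ?_
    induction hz using AddSubmonoid.closure_induction with
    | mem z h =>
      obtain ⟨l, x, hx, y, hy, rfl⟩ := h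
      rw [← mul_assoc]
      exact mul_mem_mulFam (mul_mem_mulFam hr hx) hy
    | zero => simp
    | add _ _ _ _ h₁ h₂ => rw [mul_add]; exact add_mem h₁ h₂

variable (δ) in
/-- Families of additive submonoids preserved by the shift `Λ`. -/
def ShiftStable (S : ℕ → ℕ → AddSubmonoid A) : Prop :=
  ∀ s i j, ∀ x ∈ S i j, (⇑δ)^[s] x ∈ S (i + s) (j + s)

lemma ShiftStable.mulFam {S T : ℕ → ℕ → AddSubmonoid A} (hS : ShiftStable δ S)
    (hT : ShiftStable δ T) : ShiftStable δ (mulFam S T) := by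
  intro s i j z hz
  induction hz using AddSubmonoid.closure_induction with
  | mem z h =>
    obtain ⟨l, x, hx, y, hy, rfl⟩ := h
    rw [iterate_mul]
    exact mul_mem_mulFam (hS s i l x hx) (hT s l j y hy)
  | zero => rw [iterate_zero]; exact zero_mem _
  | add _ _ _ _ h₁ h₂ => rw [iterate_add]; exact add_mem h₁ h₂

lemma matSpace_mono {S T : ℕ → ℕ → AddSubmonoid A} (h : S ≤ T) : matSpace S ≤ matSpace T :=
  fun _ ha => ⟨ha.1, fun i j => h i j (ha.2 i j)⟩

lemma conv_mem {S T : ℕ → ℕ → AddSubmonoid A} (hS : ShiftStable δ S) (hT : ShiftStable δ T)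
    {a b : ℕ → ℕ → A} (ha : a ∈ matSpace S) (hb : b ∈ matSpace T) :
    conv δ a b ∈ matSpace (mulFam S T) :=
  ⟨conv_finite ha.1 hb.1, conv_entry_mem ha.2 hb.2
    (fun _ m n s _ y hx hy => mul_mem_mulFam hx (hT s m n y hy))
    (fun i m _ s x _ hx hy => mul_mem_mulFam (hS s i m x hx) hy)⟩

lemma prodSet_matSpace {S T : ℕ → ℕ → AddSubmonoid A} (hS : ShiftStable δ S)
    (hT : ShiftStable δ T) :
    prodSet δ (matSpace S) (matSpace T) = (matSpace (mulFam S T) : Set (ℕ → ℕ → A)) := by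
  refine congrArg SetLike.coe (le_antisymm ((AddSubmonoid.closure_le).2 ?_) fun c hc => ?_)
  · rintro _ ⟨a, ha, b, hb, rfl⟩
    exact conv_mem hS hT ha hb
  · rw [eq_sum_single hc.1]
    refine sum_mem fun p _ => ?_
    have h := hc.2 p.1 p.2
    generalize c p.1 p.2 = z at h
    induction h using AddSubmonoid.closure_induction with
    | mem z h =>
      obtain ⟨m, x, hx, y, hy, rfl⟩ := h
      exact AddSubmonoid.subset_closure
        ⟨_, single_mem hx, _, single_mem hy, (conv_single _ _ _ _ _).symm⟩
    | zero => rw [map_zero]; exact zero_mem _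
    | add _ _ _ _ h₁ h₂ => rw [map_add]; exact add_mem h₁ h₂

end Space

section Diagonal

variable (δ : A →⋆ₙₐ[ℂ] A)

/-- The entry spaces of `k`-diagonal matrices. -/
def diagFam (k : ℤ) (i j : ℕ) : AddSubmonoid A where
  carrier := {x | x ∈ corner δ i j ∧ (x ≠ 0 → (j : ℤ) - i = k)}
  zero_mem' := ⟨zero_mem _, fun h => absurd rfl h⟩
  add_mem' {x y} hx hy := ⟨add_mem hx.1 hy.1, fun h => by
    by_cases h0 : x = 0
    · exact hy.2 (by simpa [h0] using h)
    · exact hx.2 h0⟩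

/-- The entry spaces of the ideal `M_k ⋆ M_k*`. -/
abbrev idealFam (k : ℤ) : ℕ → ℕ → AddSubmonoid A := mulFam (diagFam δ k) (diagFam δ (-k))

lemma Mdiag_eq (k : ℤ) : Mdiag δ k = (matSpace (diagFam δ k) : Set (ℕ → ℕ → A)) :=
  Set.ext fun _ => ⟨fun h => ⟨h.1.1, fun i j => ⟨h.1.2 i j, h.2 i j⟩⟩,
    fun h => ⟨⟨h.1, fun i j => (h.2 i j).1⟩, fun i j => (h.2 i j).2⟩⟩

lemma shiftStable_diagFam (k : ℤ) : ShiftStable δ (diagFam δ k) := fun s i j x hx =>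
  ⟨iterate_mem_corner s hx.1, fun h => by
    have := hx.2 (fun h0 => h (by rw [h0, iterate_zero]))
    omega⟩

lemma shiftStable_idealFam (k : ℤ) : ShiftStable δ (idealFam δ k) :=
  (shiftStable_diagFam δ k).mulFam (shiftStable_diagFam δ (-k))

lemma mulFam_diagFam_le (k l : ℤ) :
    mulFam (diagFam δ k) (diagFam δ l) ≤ diagFam δ (k + l) :=
  mulFam_le fun i m j x hx y hy => ⟨mul_mem_corner hx.1 hy.1, fun h => by
    have h₁ := hx.2 (left_ne_zero_of_mul h)
    have h₂ := hy.2 (right_ne_zero_of_mul h)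
    omega⟩

lemma idealFam_le (k : ℤ) : idealFam δ k ≤ diagFam δ 0 := by
  simpa using mulFam_diagFam_le δ k (-k)

lemma mulFam_diagFam_idealFam_le (k : ℤ) :
    mulFam (diagFam δ 0) (idealFam δ k) ≤ idealFam δ k := by
  rw [← mulFam_assoc]
  exact mulFam_mono (by simpa using mulFam_diagFam_le δ 0 k) le_rfl

lemma mulFam_idealFam_diagFam_le (k : ℤ) :
    mulFam (idealFam δ k) (diagFam δ 0) ≤ idealFam δ k := by
  rw [mulFam_assoc]
  exact mulFam_mono le_rfl (by simpa using mulFam_diagFam_le δ (-k) 0)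

lemma mulFam_idealFam_diagFam (k : ℤ) :
    mulFam (idealFam δ k) (diagFam δ k) = diagFam δ k := by
  apply le_antisymm
  · refine (mulFam_mono (idealFam_le δ k) le_rfl).trans ?_
    simpa using mulFam_diagFam_le δ 0 k
  intro i j x hx
  by_cases h0 : x = 0
  · rw [h0]; exact zero_mem _
  have hk := hx.2 h0
  rcases le_total i j with h | h
  · rw [← mul_unit_of_mem hx.1, ← unit_mul_unit δ (le_refl j), ← mul_assoc]
    exact mul_mem_mulFam (mul_mem_mulFam hx
      ⟨corner_mono le_rfl h (unit_mem_corner j), fun _ => by omega⟩)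
      ⟨corner_mono h le_rfl (unit_mem_corner j), fun _ => hk⟩
  · rw [← unit_mul_of_mem hx.1, ← unit_mul_unit δ (le_refl i)]
    exact mul_mem_mulFam (mul_mem_mulFam
      ⟨corner_mono le_rfl h (unit_mem_corner i), fun _ => hk⟩
      ⟨corner_mono h le_rfl (unit_mem_corner i), fun _ => by omega⟩) hx

lemma mul_mem_idealFam {k : ℤ} {i m j : ℕ} (hm : (m : ℤ) - i = k) (h : m ≤ j) {x y : A}
    (hx : x ∈ corner δ i j) (hy : y ∈ corner δ j i) : x * y ∈ idealFam δ k i i :=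
  mul_mem_mulFam (m := m) ⟨corner_mono le_rfl h hx, fun _ => hm⟩
    ⟨corner_mono h le_rfl hy, fun _ => by omega⟩

lemma exists_factor_max {i m : ℕ} {x y : A} (hx : x ∈ corner δ i m) (hy : y ∈ corner δ m i) :
    ∃ x' ∈ corner δ i (max i m), ∃ y' ∈ corner δ (max i m) i, x' * y' = x * y := by
  rcases le_total i m with h | h
  · rw [max_eq_right h]
    exact ⟨x, hx, y, hy, rfl⟩
  · rw [max_eq_left h]
    exact ⟨_, unit_mem_corner i, _, mul_mem_corner hx hy,
      unit_mul_of_mem (mul_mem_corner hx hy)⟩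

lemma mul_mem_mulFam_idealFam {k l : ℤ} {i m n : ℕ} (hm : (m : ℤ) - i = k)
    (hn : (n : ℤ) - i = l) {x y z w : A} (hx : x ∈ corner δ i m) (hy : y ∈ corner δ m i)
    (hz : z ∈ corner δ i n) (hw : w ∈ corner δ n i) :
    x * y * (z * w) ∈ mulFam (idealFam δ l) (idealFam δ k) i i := by
  obtain ⟨x, hx, y, hy, h₁⟩ := exists_factor_max δ hx hy
  obtain ⟨z, hz, w, hw, h₂⟩ := exists_factor_max δ hz hw
  rw [← h₁, ← h₂]
  rcases le_total (max i m) (max i n) with h | h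
  · have e : x * y * (z * w) =
        (x * y * z * (⇑δ)^[max i n] 1) * ((⇑δ)^[max i n] 1 * w) := by
      rw [unit_mul_of_mem hw, mul_assoc _ z, mul_unit_of_mem hz, mul_assoc _ z]
    rw [e]
    refine mul_mem_mulFam (mul_mem_idealFam δ hn (le_max_right _ _)
      (mul_mem_corner (mul_mem_corner hx hy) hz)
      (corner_mono le_rfl (le_max_left _ _) (unit_mem_corner _)))
      (mul_mem_idealFam δ hm ((le_max_right i m).trans h)
      (corner_mono (le_max_left _ _) le_rfl (unit_mem_corner _)) hw)
  · have e : x * y * (z * w) =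
        (x * (⇑δ)^[max i m] 1) * ((⇑δ)^[max i m] 1 * (y * (z * w))) := by
      rw [mul_unit_of_mem hx, ← mul_assoc _ y, unit_mul_of_mem hy, mul_assoc]
    rw [e]
    refine mul_mem_mulFam (mul_mem_idealFam δ hn ((le_max_right i n).trans h) hx
      (corner_mono le_rfl (le_max_left _ _) (unit_mem_corner _)))
      (mul_mem_idealFam δ hm (le_max_right _ _)
      (corner_mono (le_max_left _ _) le_rfl (unit_mem_corner _))
      (mul_mem_corner hy (mul_mem_corner hz hw)))

lemma mulFam_idealFam_le (k l : ℤ) :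
    mulFam (idealFam δ k) (idealFam δ l) ≤ mulFam (idealFam δ l) (idealFam δ k) := by
  refine mulFam_le fun i p j u hu v hv => ?_
  induction hu using AddSubmonoid.closure_induction with
  | zero => simp
  | add _ _ _ _ h₁ h₂ => rw [add_mul]; exact add_mem h₁ h₂
  | mem u h =>
    obtain ⟨m, x, hx, y, hy, rfl⟩ := h
    induction hv using AddSubmonoid.closure_induction with
    | zero => simp
    | add _ _ _ _ h₁ h₂ => rw [mul_add]; exact add_mem h₁ h₂
    | mem v h =>
      obtain ⟨n, z, hz, w, hw, rfl⟩ := h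
      by_cases h0 : x * y * (z * w) = 0
      · rw [h0]; exact zero_mem _
      have hxy := left_ne_zero_of_mul h0
      have hzw := right_ne_zero_of_mul h0
      have h₁ := hx.2 (left_ne_zero_of_mul hxy)
      have h₂ := hy.2 (right_ne_zero_of_mul hxy)
      have h₃ := hz.2 (left_ne_zero_of_mul hzw)
      have h₄ := hw.2 (right_ne_zero_of_mul hzw)
      obtain rfl : p = i := by omega
      obtain rfl : j = p := by omega
      exact mul_mem_mulFam_idealFam δ h₁ h₃ hx.1 hy.1 hz.1 hw.1

lemma star_mem_diagFam {k : ℤ} {i j : ℕ} {x : A} (hx : x ∈ diagFam δ k i j) :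
    star x ∈ diagFam δ (-k) j i :=
  ⟨star_mem_corner hx.1, fun h => by
    have := hx.2 (star_ne_zero.1 h)
    omega⟩

lemma star_mem_idealFam {k : ℤ} {i j : ℕ} {x : A} (hx : x ∈ idealFam δ k i j) :
    star x ∈ idealFam δ k j i := by
  induction hx using AddSubmonoid.closure_induction with
  | zero => simp
  | add _ _ _ _ h₁ h₂ => rw [star_add]; exact add_mem h₁ h₂
  | mem u h =>
    obtain ⟨m, x, hx, y, hy, rfl⟩ := h
    rw [star_mul]
    exact mul_mem_mulFam (by simpa using star_mem_diagFam δ hy) (star_mem_diagFam δ hx)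

lemma mstar_mem {S T : ℕ → ℕ → AddSubmonoid A} (h : ∀ i j, ∀ x ∈ S i j, star x ∈ T j i)
    {a : ℕ → ℕ → A} (ha : a ∈ matSpace S) : mstar a ∈ matSpace T := by
  refine ⟨?_, fun i j => h _ _ _ (ha.2 j i)⟩
  obtain ⟨N, hN⟩ := exists_bound ha.1
  exact finite_of_bound N fun i j hij => (hN j i (star_ne_zero.1 hij)).symm

lemma mstar_image_Mdiag (k : ℤ) : mstar '' Mdiag δ k = Mdiag δ (-k) := by
  rw [Mdiag_eq, Mdiag_eq]
  ext a
  constructor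
  · rintro ⟨b, hb, rfl⟩
    exact mstar_mem (fun i j x => star_mem_diagFam δ) hb
  · refine fun ha => ⟨mstar a, mstar_mem (fun i j x hx => ?_) ha, ?_⟩
    · simpa using star_mem_diagFam δ hx
    · ext i j
      simp [mstar]

lemma prodSet_Mdiag (k : ℤ) : prodSet δ (Mdiag δ k) (mstar '' Mdiag δ k) =
    (matSpace (idealFam δ k) : Set (ℕ → ℕ → A)) := by
  rw [mstar_image_Mdiag, Mdiag_eq, Mdiag_eq,
    prodSet_matSpace (shiftStable_diagFam δ k) (shiftStable_diagFam δ (-k))]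

variable {δ}

lemma diagPart_mem_Mdiag {a : ℕ → ℕ → A} (ha : MatMem δ a) (k : ℤ) :
    diagPart k a ∈ Mdiag δ k := by
  refine ⟨⟨ha.1.subset fun p hp h => hp ?_, fun i j => ?_⟩, fun i j h => ?_⟩
  · simp [diagPart, h]
  · unfold diagPart
    split_ifs
    · exact ha.2 i j
    · simp
  · by_contra h'
    exact h (if_neg h')

lemma finite_diagPart {a : ℕ → ℕ → A} (ha : MatMem δ a) :
    ({k : ℤ | diagPart k a ≠ 0}).Finite := by
  refine (ha.1.image fun p => (p.2 : ℤ) - p.1).subset fun k hk => ?_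
  by_contra h
  refine hk (funext₂ fun i j => ?_)
  unfold diagPart
  split_ifs with h'
  · by_contra h0
    exact h ⟨(i, j), h0, h'⟩
  · rfl

lemma finsum_apply_of_isDiag {b : ℤ → ℕ → ℕ → A} (hb : ({k : ℤ | b k ≠ 0}).Finite)
    (hd : ∀ k, IsDiag k (b k)) (i j : ℕ) : (∑ᶠ k, b k) i j = b ((j : ℤ) - i) i j := by
  have hb' : ({k : ℤ | b k i ≠ 0}).Finite :=
    hb.subset fun k hk h => hk (by rw [h]; rfl)
  rw [finsum_apply hb, finsum_apply hb']
  refine finsum_eq_single _ _ fun k hk => ?_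
  by_contra h
  exact hk (hd k i j h).symm

end Diagonal

end MatAlg

/-- The spaces `M_k` of `k`-diagonal matrices define a `ℤ`-graded
`*`-algebra structure on `M(A)`: `M(A) = ⊕_k M_k`, `(M_k)* = M_{−k}`,
`M_k ⋆ M_l ⊆ M_{k+l}`; `M_0` is a `*`-subalgebra, `M_k ⋆ M_{−k}` is a self-adjoint
two-sided ideal of `M_0`, `M_k ⋆ M_k* ⋆ M_k = M_k` and the ideals
`M_k ⋆ M_k*`, `M_l ⋆ M_l*` commute. -/
theorem matAlg_graded {A : Type*} [CStarAlgebra A] (δ : A →⋆ₙₐ[ℂ] A) :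
    (∀ a : ℕ → ℕ → A, MatMem δ a →
      ({k : ℤ | diagPart k a ≠ 0}).Finite ∧
      (∀ k : ℤ, diagPart k a ∈ Mdiag δ k) ∧
      a = ∑ᶠ k : ℤ, diagPart k a ∧
      (∀ b : ℤ → (ℕ → ℕ → A), ({k : ℤ | b k ≠ 0}).Finite →
        (∀ k : ℤ, b k ∈ Mdiag δ k) → a = ∑ᶠ k : ℤ, b k →
        ∀ k : ℤ, b k = diagPart k a)) ∧
    (∀ k : ℤ, mstar '' Mdiag δ k = Mdiag δ (-k)) ∧
    (∀ k l : ℤ, ∀ a ∈ Mdiag δ k, ∀ b ∈ Mdiag δ l, conv δ a b ∈ Mdiag δ (k + l)) ∧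
    (∀ k : ℤ,
      prodSet δ (Mdiag δ k) (mstar '' Mdiag δ k) ⊆ Mdiag δ 0 ∧
      (∀ x ∈ prodSet δ (Mdiag δ k) (mstar '' Mdiag δ k),
        mstar x ∈ prodSet δ (Mdiag δ k) (mstar '' Mdiag δ k)) ∧
      (∀ x ∈ Mdiag δ 0, ∀ y ∈ prodSet δ (Mdiag δ k) (mstar '' Mdiag δ k),
        conv δ x y ∈ prodSet δ (Mdiag δ k) (mstar '' Mdiag δ k) ∧
        conv δ y x ∈ prodSet δ (Mdiag δ k) (mstar '' Mdiag δ k))) ∧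
    (∀ k : ℤ,
      prodSet δ (prodSet δ (Mdiag δ k) (mstar '' Mdiag δ k)) (Mdiag δ k) =
        Mdiag δ k) ∧
    (∀ k l : ℤ,
      prodSet δ (prodSet δ (Mdiag δ k) (mstar '' Mdiag δ k))
          (prodSet δ (Mdiag δ l) (mstar '' Mdiag δ l)) =
        prodSet δ (prodSet δ (Mdiag δ l) (mstar '' Mdiag δ l))
          (prodSet δ (Mdiag δ k) (mstar '' Mdiag δ k))) := by
  refine ⟨fun a ha => ⟨MatAlg.finite_diagPart ha, MatAlg.diagPart_mem_Mdiag ha, ?_, ?_⟩,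
    MatAlg.mstar_image_Mdiag δ, ?_, fun k => ?_, fun k => ?_, fun k l => ?_⟩
  · ext i j
    rw [MatAlg.finsum_apply_of_isDiag (MatAlg.finite_diagPart ha)
      fun k => (MatAlg.diagPart_mem_Mdiag ha k).2]
    simp [diagPart]
  · rintro b hb hd rfl k
    ext i j
    rw [diagPart, MatAlg.finsum_apply_of_isDiag hb fun k => (hd k).2]
    split_ifs with h
    · rw [h]
    · by_contra h0
      exact h ((hd k).2 i j h0)
  · intro k l a ha b hb
    rw [MatAlg.Mdiag_eq] at *
    exact MatAlg.matSpace_mono (MatAlg.mulFam_diagFam_le δ k l)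
      (MatAlg.conv_mem (MatAlg.shiftStable_diagFam δ k) (MatAlg.shiftStable_diagFam δ l) ha hb)
  · rw [MatAlg.prodSet_Mdiag, MatAlg.Mdiag_eq]
    refine ⟨MatAlg.matSpace_mono (MatAlg.idealFam_le δ k),
      fun x hx => MatAlg.mstar_mem (fun i j x => MatAlg.star_mem_idealFam δ) hx,
      fun x hx y hy => ⟨?_, ?_⟩⟩
    · exact MatAlg.matSpace_mono (MatAlg.mulFam_diagFam_idealFam_le δ k)
        (MatAlg.conv_mem (MatAlg.shiftStable_diagFam δ 0) (MatAlg.shiftStable_idealFam δ k) hx hy)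
    · exact MatAlg.matSpace_mono (MatAlg.mulFam_idealFam_diagFam_le δ k)
        (MatAlg.conv_mem (MatAlg.shiftStable_idealFam δ k) (MatAlg.shiftStable_diagFam δ 0) hy hx)
  · rw [MatAlg.prodSet_Mdiag, MatAlg.Mdiag_eq, MatAlg.prodSet_matSpace
      (MatAlg.shiftStable_idealFam δ k) (MatAlg.shiftStable_diagFam δ k),
      MatAlg.mulFam_idealFam_diagFam]
  · rw [MatAlg.prodSet_Mdiag, MatAlg.prodSet_Mdiag,
      MatAlg.prodSet_matSpace (MatAlg.shiftStable_idealFam δ k) (MatAlg.shiftStable_idealFam δ l),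
      MatAlg.prodSet_matSpace (MatAlg.shiftStable_idealFam δ l) (MatAlg.shiftStable_idealFam δ k),
      le_antisymm (MatAlg.mulFam_idealFam_le δ k l) (MatAlg.mulFam_idealFam_le δ l k)]
end
end

section
/- Let (π,U,H) be a covariant representation of (A,δ) and for k ∈ ℤ let B_k = Ψ_{(π,U)}(M_k), the linear space of operators of the form Σ_{n=0}^N U^{*n} π(a_n^{(k)}) U^{n+k} when k ≥ 0, respectively Σ_{n=0}^N U^{*(n+|k|)} π(a_n^{(k)}) U^n when k < 0, with a_n^{(k)} ∈ δ^n(1)Aδ^{n+k}(1) for k ≥ 0 and a_n^{(k)} ∈ δ^{n−k}(1)Aδ^n(1) for k < 0. Then for all k, l ∈ ℤ: (B_k)* = B_{−k} and B_k·B_l ⊆ B_{k+l}; moreover B_0 is a *-subalgebra of B(H), B_k·(B_k)* is a self-adjoint two-sided ideal in B_0, B_k·(B_k)*·B_k = B_k, and B_k·(B_k)*·B_l·(B_l)* = B_l·(B_l)*·B_k·(B_k)*. -/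
open Filter Topology
open scoped NNReal

noncomputable section

variable {A : Type*} [CStarAlgebra A]

variable {H : Type*} [NormedAddCommGroup H] [InnerProductSpace ℂ H] [CompleteSpace H]

/-- The product of two subsets of `B(H)` (finite sums of products). -/
def prodSetOp {H : Type*} [NormedAddCommGroup H] [InnerProductSpace ℂ H]
    (S T : Set (H →L[ℂ] H)) : Set (H →L[ℂ] H) :=
  (AddSubmonoid.closure {c | ∃ x ∈ S, ∃ y ∈ T, c = x * y} : Set (H →L[ℂ] H))

section CovariantRep

variable {δ : A →⋆ₙₐ[ℂ] A} {π : A →⋆ₐ[ℂ] (H →L[ℂ] H)} {U : H →L[ℂ] H}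

namespace IsCovariantRep

lemma mul_map (h : IsCovariantRep δ π U) (a : A) : U * π a = π (δ a) * U := by
  obtain ⟨-, hU, hδ, hcomm⟩ := h
  calc U * π a = U * star U * U * π a := by rw [hU]
    _ = U * (star U * U * π a) := by simp only [mul_assoc]
    _ = U * π a * star U * U := by rw [hcomm]; simp only [mul_assoc]
    _ = π (δ a) * U := by rw [hδ]

lemma pow_mul_map (h : IsCovariantRep δ π U) (n : ℕ) (a : A) :
    U ^ n * π a = π (δ^[n] a) * U ^ n := by
  induction n generalizing a with
  | zero => simp
  | succ n ih =>
    rw [pow_succ, mul_assoc, h.mul_map, ← mul_assoc, ih, mul_assoc, Function.iterate_succ_apply]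

lemma map_mul_star_pow (h : IsCovariantRep δ π U) (n : ℕ) (a : A) :
    π a * star U ^ n = star U ^ n * π (δ^[n] a) := by
  have hs : δ^[n] (star a) = star (δ^[n] a) :=
    (Function.Commute.iterate_left (f := δ) (g := star) (fun x => map_star δ x) n) a
  have := congrArg star (h.pow_mul_map n (star a))
  simpa [hs, star_mul, star_pow, ← map_star] using this

lemma pow_mul_star_pow (h : IsCovariantRep δ π U) (n : ℕ) :
    U ^ n * star U ^ n = π (δ^[n] 1) := by
  induction n with
  | zero => simp
  | succ n ih =>
    rw [pow_succ' U, pow_succ (star U), Function.iterate_succ_apply', ← h.2.2.1, ← ih]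
    simp only [mul_assoc]

lemma pow_mul_star_pow_mul_pow (h : IsCovariantRep δ π U) (n : ℕ) :
    U ^ n * star U ^ n * U ^ n = U ^ n := by
  induction n with
  | zero => simp
  | succ n ih =>
    calc U ^ (n + 1) * star U ^ (n + 1) * U ^ (n + 1)
        = U * (U ^ n * star U ^ n * (star U * U)) * U ^ n := by
          rw [pow_succ' U, pow_succ (star U)]; simp only [mul_assoc]
      _ = U * star U * U * (U ^ n * star U ^ n * U ^ n) := by
          rw [h.pow_mul_star_pow, ← h.2.2.2]; simp only [mul_assoc]
      _ = U ^ (n + 1) := by rw [h.2.1, ih, pow_succ']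

lemma star_pow_mul_pow_mul_star_pow (h : IsCovariantRep δ π U) (n : ℕ) :
    star U ^ n * U ^ n * star U ^ n = star U ^ n := by
  simpa [star_mul, star_pow, mul_assoc] using congrArg star (h.pow_mul_star_pow_mul_pow n)

end IsCovariantRep

lemma isIdempotentElem_iterate_one (δ : A →⋆ₙₐ[ℂ] A) (n : ℕ) :
    IsIdempotentElem (δ^[n] (1 : A)) := by
  rw [IsIdempotentElem, ← iterate_map_mul, one_mul]

/-- The linear span of the operators `U^{*m} π(a) U^n` with `n - m = k`. -/
def spectralSubspace (π : A →⋆ₐ[ℂ] (H →L[ℂ] H)) (U : H →L[ℂ] H) (k : ℤ) :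
    Submodule ℂ (H →L[ℂ] H) :=
  Submodule.span ℂ {x | ∃ (m n : ℕ) (a : A), (n : ℤ) - m = k ∧ x = star U ^ m * π a * U ^ n}

lemma monomial_mem_spectralSubspace {k : ℤ} {m n : ℕ} (a : A) (h : (n : ℤ) - m = k) :
    star U ^ m * π a * U ^ n ∈ spectralSubspace π U k :=
  Submodule.subset_span ⟨m, n, a, h, rfl⟩

lemma pow_mem_spectralSubspace (n : ℕ) : U ^ n ∈ spectralSubspace π U n := by
  simpa using monomial_mem_spectralSubspace (π := π) (U := U) (m := 0) (n := n) 1 (by simp)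

lemma star_pow_mem_spectralSubspace (n : ℕ) : star U ^ n ∈ spectralSubspace π U (-n) := by
  simpa using monomial_mem_spectralSubspace (π := π) (U := U) (m := n) (n := 0) 1 (by simp)

lemma star_mem_spectralSubspace {k : ℤ} {x : H →L[ℂ] H} (hx : x ∈ spectralSubspace π U k) :
    star x ∈ spectralSubspace π U (-k) := by
  induction hx using Submodule.span_induction with
  | mem x hx =>
    obtain ⟨m, n, a, hk, rfl⟩ := hx
    have := monomial_mem_spectralSubspace (π := π) (U := U) (k := -k) (m := n) (n := m)
      (star a) (by omega)
    simpa [star_mul, star_pow, mul_assoc, map_star] using this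
  | zero => simp
  | add x y _ _ hx hy => rw [star_add]; exact add_mem hx hy
  | smul c x _ hx => rw [star_smul]; exact Submodule.smul_mem _ _ hx

lemma star_image_spectralSubspace (k : ℤ) :
    star '' (spectralSubspace π U k : Set (H →L[ℂ] H)) = spectralSubspace π U (-k) := by
  ext x
  constructor
  · rintro ⟨y, hy, rfl⟩
    exact star_mem_spectralSubspace hy
  · intro hx
    exact ⟨star x, by simpa using star_mem_spectralSubspace hx, star_star x⟩

open scoped Pointwise in
lemma prodSetOp_coe (M N : Submodule ℂ (H →L[ℂ] H)) :
    prodSetOp (M : Set (H →L[ℂ] H)) (N : Set (H →L[ℂ] H)) = ((M * N : Submodule ℂ _) : Set _) := by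
  have h : {c | ∃ x ∈ (M : Set (H →L[ℂ] H)), ∃ y ∈ (N : Set (H →L[ℂ] H)), c = x * y} =
      (M : Set (H →L[ℂ] H)) * (N : Set (H →L[ℂ] H)) := by
    ext c
    simp [Set.mem_mul, eq_comm]
  rw [prodSetOp, h, ← Submodule.coe_toAddSubmonoid (M * N), Submodule.mul_toAddSubmonoid,
    AddSubmonoid.mul_eq_closure_mul_set]
  rfl

section Psi

lemma MatMem.finite_row {a : ℕ → ℕ → A} (ha : MatMem δ a) (m : ℕ) :
    (fun n => star U ^ m * π (a m n) * U ^ n).HasFiniteSupport := by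
  refine (ha.1.image Prod.snd).subset fun n hn => ⟨(m, n), fun h => hn ?_, rfl⟩
  simp only at h
  simp [h]

lemma MatMem.finite_rows {a : ℕ → ℕ → A} (ha : MatMem δ a) :
    (fun m => ∑ᶠ n, star U ^ m * π (a m n) * U ^ n).HasFiniteSupport := by
  refine (ha.1.image Prod.fst).subset fun m hm => ?_
  by_contra hc
  refine hm ?_
  have h0 (n : ℕ) : a m n = 0 := by
    by_contra h
    exact hc ⟨(m, n), h, rfl⟩
  simp [h0]

lemma Psi_add {a b : ℕ → ℕ → A} (ha : MatMem δ a) (hb : MatMem δ b) :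
    Psi π U (a + b) = Psi π U a + Psi π U b := by
  rw [Psi, Psi, Psi, ← finsum_add_distrib ha.finite_rows hb.finite_rows]
  refine finsum_congr fun m => ?_
  rw [← finsum_add_distrib (ha.finite_row m) (hb.finite_row m)]
  simp [mul_add, add_mul]

lemma Psi_smul {a : ℕ → ℕ → A} (ha : MatMem δ a) (c : ℂ) :
    Psi π U (c • a) = c • Psi π U a := by
  rw [Psi, Psi, smul_finsum' c ha.finite_rows]
  refine finsum_congr fun m => ?_
  rw [smul_finsum' c (ha.finite_row m)]
  simp

lemma Mdiag_add {k : ℤ} {a b : ℕ → ℕ → A} (ha : a ∈ Mdiag δ k) (hb : b ∈ Mdiag δ k) :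
    a + b ∈ Mdiag δ k := by
  have h (i j : ℕ) (hij : (a + b) i j ≠ 0) : a i j ≠ 0 ∨ b i j ≠ 0 := by
    by_contra! hc
    exact hij (by simp [hc])
  refine ⟨⟨(ha.1.1.union hb.1.1).subset fun p hp => h _ _ hp, fun i j => ?_⟩, fun i j hij => ?_⟩
  · simp only [Pi.add_apply, mul_add, add_mul, ha.1.2 i j, hb.1.2 i j]
  · exact (h i j hij).elim (ha.2 i j) (hb.2 i j)

lemma Mdiag_smul {k : ℤ} {a : ℕ → ℕ → A} (ha : a ∈ Mdiag δ k) (c : ℂ) :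
    c • a ∈ Mdiag δ k := by
  have h (i j : ℕ) (hij : (c • a) i j ≠ 0) : a i j ≠ 0 := fun h0 => hij (by simp [h0])
  refine ⟨⟨ha.1.1.subset fun p hp => h _ _ hp, fun i j => ?_⟩, fun i j hij => ha.2 i j (h i j hij)⟩
  simp only [Pi.smul_apply, mul_smul_comm, smul_mul_assoc, ha.1.2 i j]

lemma zero_mem_Mdiag (k : ℤ) : (0 : ℕ → ℕ → A) ∈ Mdiag δ k := by
  simp [Mdiag, MatMem, IsDiag]

lemma Psi_single (m n : ℕ) (a : A) :
    Psi π U (Pi.single m (Pi.single n a)) = star U ^ m * π a * U ^ n := by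
  rw [Psi, finsum_eq_single _ m, finsum_eq_single _ n]
  · simp
  · intro j hj
    simp [hj]
  · intro i hi
    simp [hi]

lemma single_mem_Mdiag {k : ℤ} {m n : ℕ} (a : A) (h : (n : ℤ) - m = k) :
    Pi.single m (Pi.single n (δ^[m] 1 * a * δ^[n] 1)) ∈ Mdiag δ k := by
  have key (i j : ℕ)
      (hij : (Pi.single m (Pi.single n (δ^[m] 1 * a * δ^[n] 1)) : ℕ → ℕ → A) i j ≠ 0) :
      i = m ∧ j = n := by
    by_cases hi : i = m
    · subst hi
      by_cases hj : j = n
      · exact ⟨rfl, hj⟩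
      · simp [hj] at hij
    · simp [hi] at hij
  refine ⟨⟨(Set.finite_singleton (m, n)).subset fun p hp => Prod.ext_iff.2 (key _ _ hp),
    fun i j => ?_⟩, fun i j hij => ?_⟩
  · by_cases hij : (Pi.single m (Pi.single n (δ^[m] 1 * a * δ^[n] 1)) : ℕ → ℕ → A) i j = 0
    · simp [hij]
    · obtain ⟨rfl, rfl⟩ := key i j hij
      simp only [Pi.single_eq_same]
      have hi := (isIdempotentElem_iterate_one δ i).eq
      have hj := (isIdempotentElem_iterate_one δ j).eq
      simp only [mul_assoc, hj]
      simp only [← mul_assoc, hi]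
  · obtain ⟨rfl, rfl⟩ := key i j hij
    exact h

lemma image_Psi_Mdiag (h : IsCovariantRep δ π U) (k : ℤ) :
    Psi π U '' Mdiag δ k = spectralSubspace π U k := by
  ext x
  constructor
  · rintro ⟨a, ha, rfl⟩
    refine finsum_induction (· ∈ spectralSubspace π U k) (zero_mem _) (fun _ _ => add_mem)
      fun m => finsum_induction (· ∈ spectralSubspace π U k) (zero_mem _) (fun _ _ => add_mem)
      fun n => ?_
    by_cases h0 : a m n = 0
    · simp [h0]
    · exact monomial_mem_spectralSubspace _ (ha.2 m n h0)
  · intro hx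
    induction hx using Submodule.span_induction with
    | mem x hx =>
      obtain ⟨m, n, a, hk, rfl⟩ := hx
      refine ⟨_, single_mem_Mdiag a hk, ?_⟩
      rw [Psi_single, map_mul, map_mul, ← h.pow_mul_star_pow, ← h.pow_mul_star_pow]
      calc star U ^ m * (U ^ m * star U ^ m * π a * (U ^ n * star U ^ n)) * U ^ n
          = (star U ^ m * U ^ m * star U ^ m) * π a * (U ^ n * star U ^ n * U ^ n) := by
            simp only [mul_assoc]
        _ = _ := by rw [h.pow_mul_star_pow_mul_pow, h.star_pow_mul_pow_mul_star_pow]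
    | zero => exact ⟨0, zero_mem_Mdiag k, by simp [Psi]⟩
    | add x y _ _ hx hy =>
      obtain ⟨a, ha, rfl⟩ := hx
      obtain ⟨b, hb, rfl⟩ := hy
      exact ⟨a + b, Mdiag_add ha hb, Psi_add ha.1 hb.1⟩
    | smul c x _ hx =>
      obtain ⟨a, ha, rfl⟩ := hx
      exact ⟨c • a, Mdiag_smul ha c, Psi_smul ha.1 c⟩

end Psi

namespace IsCovariantRep

lemma spectralSubspace_mul_le (h : IsCovariantRep δ π U) (k l : ℤ) :
    spectralSubspace π U k * spectralSubspace π U l ≤ spectralSubspace π U (k + l) := by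
  rw [spectralSubspace, spectralSubspace, Submodule.span_mul_span, Submodule.span_le]
  rintro _ ⟨_, ⟨m, n, a, hk, rfl⟩, _, ⟨p, q, b, hl, rfl⟩, rfl⟩
  simp only [SetLike.mem_coe]
  obtain ⟨d, rfl⟩ | ⟨d, rfl⟩ : (∃ d, n = d + p) ∨ ∃ d, p = n + d := by
    rcases le_total p n with hpn | hpn
    · exact .inl ⟨n - p, by omega⟩
    · exact .inr ⟨p - n, by omega⟩
  · convert monomial_mem_spectralSubspace (π := π) (U := U) (m := m) (n := d + q)
      (a * δ^[d] (δ^[p] 1 * b)) (by push_cast at *; omega : _ = k + l) using 1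
    calc star U ^ m * π a * U ^ (d + p) * (star U ^ p * π b * U ^ q)
        = star U ^ m * π a * (U ^ d * ((U ^ p * star U ^ p) * π b)) * U ^ q := by
          rw [pow_add U d p]; simp only [mul_assoc]
      _ = _ := by
          rw [h.pow_mul_star_pow, ← map_mul, h.pow_mul_map, pow_add, map_mul π a]
          simp only [mul_assoc]
  · convert monomial_mem_spectralSubspace (π := π) (U := U) (m := m + d) (n := q)
      (δ^[d] (a * δ^[n] 1) * b) (by push_cast at *; omega : _ = k + l) using 1
    calc star U ^ m * π a * U ^ n * (star U ^ (n + d) * π b * U ^ q)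
        = star U ^ m * (π a * (U ^ n * star U ^ n) * star U ^ d) * π b * U ^ q := by
          rw [pow_add (star U) n d]; simp only [mul_assoc]
      _ = _ := by
          rw [h.pow_mul_star_pow, ← map_mul, h.map_mul_star_pow, pow_add, map_mul π _ b]
          simp only [mul_assoc]

lemma spectralSubspace_mul_le_of_add_eq (h : IsCovariantRep δ π U) {k l r : ℤ} (hr : k + l = r) :
    spectralSubspace π U k * spectralSubspace π U l ≤ spectralSubspace π U r :=
  hr ▸ h.spectralSubspace_mul_le k l

lemma star_pow_mul_pow_mul (h : IsCovariantRep δ π U) (l : ℕ) {x : H →L[ℂ] H}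
    (hx : x ∈ spectralSubspace π U (-l)) : star U ^ l * U ^ l * x = x := by
  induction hx using Submodule.span_induction with
  | mem x hx =>
    obtain ⟨m, n, a, hk, rfl⟩ := hx
    obtain rfl : m = l + n := by omega
    rw [pow_add]
    simp only [← mul_assoc]
    rw [h.star_pow_mul_pow_mul_star_pow]
  | zero => simp
  | add x y _ _ hx hy => rw [mul_add, hx, hy]
  | smul c x _ hx => rw [mul_smul_comm, hx]

lemma mul_star_pow_mul_pow (h : IsCovariantRep δ π U) (l : ℕ) {x : H →L[ℂ] H}
    (hx : x ∈ spectralSubspace π U l) : x * (star U ^ l * U ^ l) = x := by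
  have := congrArg star (h.star_pow_mul_pow_mul l (star_mem_spectralSubspace hx))
  simpa [star_mul, star_pow, mul_assoc] using this

lemma spectralSubspace_le_mul_mul (h : IsCovariantRep δ π U) (k : ℤ) :
    spectralSubspace π U k ≤
      spectralSubspace π U k * spectralSubspace π U (-k) * spectralSubspace π U k := by
  intro x hx
  obtain ⟨l, rfl | rfl⟩ := k.eq_nat_or_neg
  · rw [← h.mul_star_pow_mul_pow l hx, ← mul_assoc]
    exact Submodule.mul_mem_mul (Submodule.mul_mem_mul hx (star_pow_mem_spectralSubspace l))
      (pow_mem_spectralSubspace l)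
  · rw [← h.star_pow_mul_pow_mul l hx]
    refine Submodule.mul_mem_mul (Submodule.mul_mem_mul (star_pow_mem_spectralSubspace l) ?_) hx
    simpa using pow_mem_spectralSubspace l

lemma spectralSubspace_mul_mul (h : IsCovariantRep δ π U) (k : ℤ) :
    spectralSubspace π U k * spectralSubspace π U (-k) * spectralSubspace π U k =
      spectralSubspace π U k :=
  le_antisymm ((mul_le_mul_left (h.spectralSubspace_mul_le_of_add_eq (add_neg_cancel k)) _).trans
    (h.spectralSubspace_mul_le_of_add_eq (zero_add k))) (h.spectralSubspace_le_mul_mul k)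

end IsCovariantRep

/-- The ideal `B_k B_k^*` of `B_0`. -/
def spectralIdeal (π : A →⋆ₐ[ℂ] (H →L[ℂ] H)) (U : H →L[ℂ] H) (k : ℤ) :
    Submodule ℂ (H →L[ℂ] H) :=
  spectralSubspace π U k * spectralSubspace π U (-k)

lemma star_mem_spectralIdeal {k : ℤ} {x : H →L[ℂ] H} (hx : x ∈ spectralIdeal π U k) :
    star x ∈ spectralIdeal π U k := by
  induction hx using Submodule.mul_induction_on' with
  | mem_mul_mem x hx y hy =>
    rw [star_mul]
    exact Submodule.mul_mem_mul (by simpa using star_mem_spectralSubspace hy)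
      (star_mem_spectralSubspace hx)
  | add x _ y _ hx hy => rw [star_add]; exact add_mem hx hy

namespace IsCovariantRep

lemma spectralIdeal_le (h : IsCovariantRep δ π U) (k : ℤ) :
    spectralIdeal π U k ≤ spectralSubspace π U 0 :=
  h.spectralSubspace_mul_le_of_add_eq (add_neg_cancel k)

lemma zero_mul_spectralIdeal_le (h : IsCovariantRep δ π U) (k : ℤ) :
    spectralSubspace π U 0 * spectralIdeal π U k ≤ spectralIdeal π U k := by
  rw [spectralIdeal, ← mul_assoc]
  gcongr
  exact h.spectralSubspace_mul_le_of_add_eq (zero_add k)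

lemma spectralIdeal_mul_zero_le (h : IsCovariantRep δ π U) (k : ℤ) :
    spectralIdeal π U k * spectralSubspace π U 0 ≤ spectralIdeal π U k := by
  rw [spectralIdeal, mul_assoc]
  gcongr
  exact h.spectralSubspace_mul_le_of_add_eq (add_zero _)

lemma spectralIdeal_mul_self (h : IsCovariantRep δ π U) (k : ℤ) :
    spectralIdeal π U k * spectralIdeal π U k = spectralIdeal π U k := by
  rw [spectralIdeal, ← mul_assoc, h.spectralSubspace_mul_mul]

lemma spectralIdeal_mul_le_inf (h : IsCovariantRep δ π U) (k l : ℤ) :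
    spectralIdeal π U k * spectralIdeal π U l ≤ spectralIdeal π U k ⊓ spectralIdeal π U l :=
  le_inf ((mul_le_mul_right (h.spectralIdeal_le l) _).trans (h.spectralIdeal_mul_zero_le k))
    ((mul_le_mul_left (h.spectralIdeal_le k) _).trans (h.zero_mul_spectralIdeal_le l))

lemma commute_spectralIdeal_neg (h : IsCovariantRep δ π U) (k : ℤ) (l : ℕ) :
    Commute (spectralIdeal π U k) (spectralIdeal π U (-l)) := by
  have he : star U ^ l * U ^ l ∈ spectralIdeal π U (-l) :=
    Submodule.mul_mem_mul (star_pow_mem_spectralSubspace l)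
      (by simpa using pow_mem_spectralSubspace l)
  have hleft {x} (hx : x ∈ spectralIdeal π U (-l)) : star U ^ l * U ^ l * x = x := by
    induction hx using Submodule.mul_induction_on' with
    | mem_mul_mem x hx y hy => rw [← mul_assoc, h.star_pow_mul_pow_mul l hx]
    | add x _ y _ hx hy => rw [mul_add, hx, hy]
  have hright {x} (hx : x ∈ spectralIdeal π U (-l)) : x * (star U ^ l * U ^ l) = x := by
    have := congrArg star (hleft (star_mem_spectralIdeal hx))
    simpa [star_mul, star_pow, mul_assoc] using this
  apply le_antisymm
  · refine (h.spectralIdeal_mul_le_inf k (-l)).trans fun x hx => ?_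
    rw [← hleft hx.2]
    exact Submodule.mul_mem_mul he hx.1
  · refine (h.spectralIdeal_mul_le_inf (-l) k).trans fun x hx => ?_
    rw [← hright hx.1]
    exact Submodule.mul_mem_mul hx.2 he

lemma spectralIdeal_anti (h : IsCovariantRep δ π U) {k l : ℕ} (hkl : k ≤ l) :
    spectralIdeal π U l ≤ spectralIdeal π U k := by
  have hl : spectralSubspace π U l ≤ spectralSubspace π U k * spectralSubspace π U (l - k) := by
    rw [spectralSubspace, Submodule.span_le]
    rintro _ ⟨m, n, a, hn, rfl⟩
    obtain rfl : n = m + k + (l - k) := by omega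
    rw [pow_add, ← mul_assoc]
    refine Submodule.mul_mem_mul (monomial_mem_spectralSubspace _ (by push_cast; omega)) ?_
    rw [← Nat.cast_sub hkl]
    exact pow_mem_spectralSubspace _
  calc spectralIdeal π U l
      ≤ spectralSubspace π U k * spectralSubspace π U (l - k) * spectralSubspace π U (-l) :=
        mul_le_mul_left hl _
    _ ≤ spectralIdeal π U k := by
        rw [spectralIdeal, mul_assoc]
        gcongr
        exact h.spectralSubspace_mul_le_of_add_eq (by ring)

lemma commute_of_spectralIdeal_le (h : IsCovariantRep δ π U) {k l : ℤ}
    (hle : spectralIdeal π U l ≤ spectralIdeal π U k) :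
    Commute (spectralIdeal π U k) (spectralIdeal π U l) := by
  have hl : spectralIdeal π U k * spectralIdeal π U l = spectralIdeal π U l :=
    le_antisymm ((h.spectralIdeal_mul_le_inf k l).trans inf_le_right)
      ((h.spectralIdeal_mul_self l).ge.trans (mul_le_mul_left hle _))
  have hr : spectralIdeal π U l * spectralIdeal π U k = spectralIdeal π U l :=
    le_antisymm ((h.spectralIdeal_mul_le_inf l k).trans inf_le_left)
      ((h.spectralIdeal_mul_self l).ge.trans (mul_le_mul_right hle _))
  exact hl.trans hr.symm

lemma commute_spectralIdeal (h : IsCovariantRep δ π U) (k l : ℤ) :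
    Commute (spectralIdeal π U k) (spectralIdeal π U l) := by
  obtain ⟨l, rfl | rfl⟩ := l.eq_nat_or_neg
  · obtain ⟨k, rfl | rfl⟩ := k.eq_nat_or_neg
    · rcases le_total k l with hkl | hkl
      · exact h.commute_of_spectralIdeal_le (h.spectralIdeal_anti hkl)
      · exact (h.commute_of_spectralIdeal_le (h.spectralIdeal_anti hkl)).symm
    · exact (h.commute_spectralIdeal_neg l k).symm
  · exact h.commute_spectralIdeal_neg k l

end IsCovariantRep

end CovariantRep

/-- Let `(π, U, H)` be a covariant representation of `(A, δ)` and
`B_k = Ψ_{(π,U)}(M_k)`.  Then `(B_k)* = B_{−k}`, `B_k·B_l ⊆ B_{k+l}`, `B_0` is a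
`*`-subalgebra of `B(H)`, `B_k·B_k*` is a self-adjoint two-sided ideal in `B_0`,
`B_k·B_k*·B_k = B_k` and the ideals `B_k·B_k*`, `B_l·B_l*` commute. -/
theorem spectral_subspaces_operators {A : Type*} [CStarAlgebra A] (δ : A →⋆ₙₐ[ℂ] A)
    {H : Type*} [NormedAddCommGroup H] [InnerProductSpace ℂ H] [CompleteSpace H]
    (π : A →⋆ₐ[ℂ] (H →L[ℂ] H)) (U : H →L[ℂ] H)
    (hrep : IsCovariantRep δ π U) :
    (∀ k : ℤ, star '' (Psi π U '' Mdiag δ k) = Psi π U '' Mdiag δ (-k)) ∧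
    (∀ k l : ℤ, ∀ x ∈ Psi π U '' Mdiag δ k, ∀ y ∈ Psi π U '' Mdiag δ l,
      x * y ∈ Psi π U '' Mdiag δ (k + l)) ∧
    (∀ x ∈ Psi π U '' Mdiag δ 0, ∀ y ∈ Psi π U '' Mdiag δ 0,
      x + y ∈ Psi π U '' Mdiag δ 0 ∧ x * y ∈ Psi π U '' Mdiag δ 0 ∧
      star x ∈ Psi π U '' Mdiag δ 0) ∧
    (∀ (z : ℂ), ∀ x ∈ Psi π U '' Mdiag δ 0, z • x ∈ Psi π U '' Mdiag δ 0) ∧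
    (∀ k : ℤ,
      prodSetOp (Psi π U '' Mdiag δ k) (star '' (Psi π U '' Mdiag δ k)) ⊆
        Psi π U '' Mdiag δ 0 ∧
      (∀ x ∈ prodSetOp (Psi π U '' Mdiag δ k) (star '' (Psi π U '' Mdiag δ k)),
        star x ∈ prodSetOp (Psi π U '' Mdiag δ k) (star '' (Psi π U '' Mdiag δ k))) ∧
      (∀ x ∈ Psi π U '' Mdiag δ 0,
        ∀ y ∈ prodSetOp (Psi π U '' Mdiag δ k) (star '' (Psi π U '' Mdiag δ k)),
        x * y ∈ prodSetOp (Psi π U '' Mdiag δ k) (star '' (Psi π U '' Mdiag δ k)) ∧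
        y * x ∈ prodSetOp (Psi π U '' Mdiag δ k) (star '' (Psi π U '' Mdiag δ k)))) ∧
    (∀ k : ℤ,
      prodSetOp
          (prodSetOp (Psi π U '' Mdiag δ k) (star '' (Psi π U '' Mdiag δ k)))
          (Psi π U '' Mdiag δ k) =
        Psi π U '' Mdiag δ k) ∧
    (∀ k l : ℤ,
      prodSetOp
          (prodSetOp (Psi π U '' Mdiag δ k) (star '' (Psi π U '' Mdiag δ k)))
          (prodSetOp (Psi π U '' Mdiag δ l) (star '' (Psi π U '' Mdiag δ l))) =
        prodSetOp
          (prodSetOp (Psi π U '' Mdiag δ l) (star '' (Psi π U '' Mdiag δ l)))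
          (prodSetOp (Psi π U '' Mdiag δ k) (star '' (Psi π U '' Mdiag δ k)))) := by
  simp only [image_Psi_Mdiag hrep, star_image_spectralSubspace, prodSetOp_coe, SetLike.mem_coe]
  have hmul {k l r : ℤ} (hr : k + l = r) {x y : H →L[ℂ] H} (hx : x ∈ spectralSubspace π U k)
      (hy : y ∈ spectralSubspace π U l) : x * y ∈ spectralSubspace π U r :=
    hrep.spectralSubspace_mul_le_of_add_eq hr (Submodule.mul_mem_mul hx hy)
  refine ⟨fun _ => trivial, fun k l x hx y hy => hmul rfl hx hy, fun x hx y hy =>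
    ⟨add_mem hx hy, hmul (add_zero 0) hx hy, by simpa using star_mem_spectralSubspace hx⟩,
    fun z x hx => Submodule.smul_mem _ z hx,
    fun k => ⟨hrep.spectralIdeal_le k, fun x hx => star_mem_spectralIdeal hx, fun x hx y hy =>
      ⟨hrep.zero_mul_spectralIdeal_le k (Submodule.mul_mem_mul hx hy),
        hrep.spectralIdeal_mul_zero_le k (Submodule.mul_mem_mul hy hx)⟩⟩,
    fun k => congrArg _ (hrep.spectralSubspace_mul_mul k),
    fun k l => congrArg _ (hrep.commute_spectralIdeal k l).eq⟩
end
end
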